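/- Let r ≥ 0 be an integer, let k_0 =: q, k_1, …, k_r be positive integers, and let x_0, x_1, …, x_r be roots of unity such that (k_0, x_0) ≠ (1,1), (k_r, x_r) ≠ (1,1) and X := x_0 x_1 ⋯ x_r ≠ 1. For an integer t ≥ 1 set E_t := (−1)^t Li_t(X^{−1}) + Li_t(X), and set E_0 := −1. Then Li_{k_0,k_1,…,k_r}(x_0,x_1,…,x_r) + Σ_{j=0}^{r} (−1)^{k_0+⋯+k_j} Li_{k_{j+1},…,k_r}(x_{j+1},…,x_r) · Li_{k_j,k_{j−1},…,k_0}(x_j^{−1}, x_{j−1}^{−1},…, x_0^{−1}) − Σ_{j=0}^{q} Σ_{m_1+⋯+m_r=q−j, all m_l ≥ 0} B_{q−j}(k; m) · E_j · Li_{k_1+m_1,…,k_r+m_r}(x_1,…,x_r) − Σ_{j=1}^{r} Σ_{i ≥ 0, m ≥ 0, i+m ≤ k_j} Σ_{(m_l)_{l≠j} nonnegative with Σ_{l≠j} m_l = m, and m_j := 0} (−1)^{k_0+⋯+k_{j−1}+m_{j+1}+⋯+m_r} C(q+k_j−m−i−1, q−1) (Π_{l≠j} C(m_l+k_l−1, k_l−1))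 · E_i · Li_{k_{j+1}+m_{j+1},…,k_r+m_r}(x_{j+1},…,x_r) · Li_{k_{j−1}+m_{j−1},…,k_1+m_1, q+k_j−i−m}(x_{j−1}^{−1},…,x_1^{−1}, x_0^{−1}) = 0. -/

import Mathlib

open Filter Finset

/-- A complex number is a root of unity if some positive power of it equals 1. -/
def IsRootOfUnity (z : ℂ) : Prop := ∃ N : ℕ, 0 < N ∧ z ^ N = 1

open scoped Classical in
/-- Partial sum `Σ_{0<n_1<⋯<n_r≤N} Π_j x_j^{n_j} (n_j + b_j − 1)^{−k_j}` where the list `K`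
consists of the triples `(k_j, x_j, b_j)`. -/
noncomputable def cmhzP (K : List (ℕ × ℂ × ℂ)) (N : ℕ) : ℂ :=
  ∑ n ∈ Finset.univ.filter (fun n : Fin K.length → Fin N => StrictMono n),
    ∏ j : Fin K.length,
      (K.get j).2.1 ^ ((n j : ℕ) + 1) /
        ((((n j : ℕ) + 1 : ℕ) : ℂ) + (K.get j).2.2 - 1) ^ (K.get j).1

/-- Cyclotomic multiple Hurwitz zeta value: the limit of the partial sums `cmhzP`. -/
noncomputable def cmhz (K : List (ℕ × ℂ × ℂ)) : ℂ := limUnder atTop (cmhzP K)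

/-- Cyclotomic multiple zeta value (all Hurwitz parameters equal to 1). -/
noncomputable def cmzv (K : List (ℕ × ℂ)) : ℂ := cmhz (K.map fun p => (p.1, p.2, 1))

/-- Cyclotomic multiple t-value (all Hurwitz parameters equal to 1/2). -/
noncomputable def tval (K : List (ℕ × ℂ)) : ℂ := cmhz (K.map fun p => (p.1, p.2, (1 : ℂ)/2))

/-- Depth-one cyclotomic zeta value `Li_k(x)`. -/
noncomputable def li1 (k : ℕ) (x : ℂ) : ℂ := cmzv [(k, x)]

/-- Depth-one cyclotomic Hurwitz zeta value `Li_k(x; b)`. -/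
noncomputable def lih1 (k : ℕ) (x b : ℂ) : ℂ := cmhz [(k, x, b)]

/-- Depth-one cyclotomic t-value `t_k(x)`. -/
noncomputable def tval1 (k : ℕ) (x : ℂ) : ℂ := tval [(k, x)]

/-- The generalized digamma-type series `φ(s; x) = Σ_{k≥0} x^k/(k+s)`. -/
noncomputable def phiF (s x : ℂ) : ℂ :=
  limUnder atTop (fun N : ℕ => ∑ t ∈ Finset.range (N + 1), x ^ t / ((t : ℂ) + s))

/-- The extended trigonometric function `Φ(s; x) = φ(s; x) − φ(−s; x⁻¹) − 1/s`. -/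
noncomputable def PhiF (s x : ℂ) : ℂ := phiF s x - phiF (-s) x⁻¹ - 1 / s


namespace SymC

noncomputable def hh (p : ℕ × ℂ) (m : ℤ) : ℂ := p.2 ^ m / (m : ℂ) ^ p.1

noncomputable def CL : List (ℤ → ℂ) → ℤ → ℤ → ℂ
  | [], _, _ => 1
  | f :: H, lo, hi => ∑ m ∈ Finset.Ioo lo hi, f m * CL H m hi

lemma CL_append (H1 : List (ℤ → ℂ)) (f : ℤ → ℂ) (H2 : List (ℤ → ℂ)) (lo hi : ℤ) :
    CL (H1 ++ f :: H2) lo hi = ∑ m ∈ Finset.Ioo lo hi, CL H1 lo m * f m * CL H2 m hi := by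
  induction H1 generalizing lo with
  | nil => simp [CL]
  | cons g H1 ih =>
    simp only [List.cons_append, CL]
    simp_rw [ih, Finset.mul_sum, Finset.sum_mul]
    rw [Finset.sum_comm' (t' := Finset.Ioo lo hi) (s' := fun m => Finset.Ioo lo m)]
    · refine Finset.sum_congr rfl fun m _ => Finset.sum_congr rfl fun a _ => by ring
    · intro a m; simp only [Finset.mem_Ioo]; omega

lemma CL_shift (H : List (ℤ → ℂ)) (p lo hi : ℤ) :
    CL (H.map (fun f m => f (m - p))) (lo + p) (hi + p) = CL H lo hi := by
  induction H generalizing lo with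
  | nil => simp [CL]
  | cons g H ih =>
    simp only [List.map_cons, CL]
    refine (Finset.sum_bij (fun m _ => m + p) ?_ ?_ ?_ ?_).symm
    · intro a; simp
    · intro a _ b _; simp
    · intro b hb; refine ⟨b - p, ?_, by ring⟩
      simp only [Finset.mem_Ioo] at *; omega
    · intro a _; rw [ih]; simp

lemma CL_rev (H : List (ℤ → ℂ)) (lo hi : ℤ) :
    CL (H.reverse.map (fun f m => f (-m))) (-hi) (-lo) = CL H lo hi := by
  induction H generalizing lo with
  | nil => simp [CL]
  | cons g H ih =>
    simp only [List.reverse_cons, List.map_append, List.map_cons, List.map_nil, CL_append, CL]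
    refine (Finset.sum_bij (fun m _ => -m) ?_ ?_ ?_ ?_).symm
    · intro a; simp; omega
    · intro a _ b _; simp
    · intro b hb; refine ⟨-b, ?_, by ring⟩
      simp only [Finset.mem_Ioo] at *; omega
    · intro a _; rw [ih]; simp; ring

lemma CL_empty (H : List (ℤ → ℂ)) (hH : H ≠ []) (lo hi : ℤ) (h : hi ≤ lo + 1) :
    CL H lo hi = 0 := by
  cases H with
  | nil => exact absurd rfl hH
  | cons f H =>
    simp only [CL]
    rw [Ioo_empty_aux lo hi h]
    simp
where
  Ioo_empty_aux (a b : ℤ) (h : b ≤ a + 1) : Finset.Ioo a b = ∅ := by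
    ext x; simp; omega

lemma CL_sign (H : List (ℤ → ℂ)) (h0 : ∀ f ∈ H, f 0 = 0) (lo hi : ℤ) (hlo : lo < 0)
    (hhi : 0 < hi) :
    CL H lo hi = ∑ j ∈ Finset.range (H.length + 1),
      CL (H.take j) lo 0 * CL (H.drop j) 0 hi := by
  induction H generalizing lo with
  | nil => simp [CL]
  | cons f H ih =>
    rw [List.length_cons, Finset.sum_range_succ']
    simp only [List.take_succ_cons, List.drop_succ_cons, List.take_zero, List.drop_zero, CL]
    have : Finset.Ioo lo hi = (Finset.Ioo lo 0 ∪ {0}) ∪ Finset.Ioo 0 hi := by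
      ext x; simp; omega
    rw [this, Finset.sum_union, Finset.sum_union]
    · simp only [Finset.sum_singleton, h0 f (by simp), zero_mul, add_zero, one_mul]
      congr 1
      simp_rw [Finset.sum_mul]
      rw [Finset.sum_comm]
      refine Finset.sum_congr rfl fun m hm => ?_
      rw [ih (fun g hg => h0 g (by simp [hg])) m (by simp at hm; omega), Finset.mul_sum]
      refine Finset.sum_congr rfl fun j _ => by ring
    · rw [Finset.disjoint_left]; intro x; simp; omega
    · rw [Finset.disjoint_left]; intro x; simp; omega

lemma CL_sign' (H : List (ℤ → ℂ)) (h0 : ∀ f ∈ H, f 0 = 0) (lo hi : ℤ) (hlo : lo < 0) :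
    CL H lo hi = CL H lo (min 0 hi) + ∑ j ∈ Finset.range H.length,
      CL (H.take j) lo 0 * CL (H.drop j) 0 hi := by
  rcases lt_or_ge 0 hi with h | h
  · rw [CL_sign H h0 lo hi hlo h, Finset.sum_range_succ, min_eq_left h.le]
    simp [CL]; ring
  · rw [min_eq_right h, Finset.sum_eq_zero, add_zero]
    intro j hj
    rw [CL_empty (H.drop j) _ 0 hi (by omega), mul_zero]
    simp at hj ⊢; omega

/-- partial sums with pair lists -/
noncomputable def CP (K : List (ℕ × ℂ)) (lo hi : ℤ) : ℂ := CL (K.map hh) lo hi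

open scoped Classical in
lemma cmhzP_aux (K : List (ℕ × ℂ)) (N lo : ℕ) :
    ∑ n ∈ Finset.univ.filter (fun n : Fin (K.map fun p => ((p.1, p.2, 1) : ℕ × ℂ × ℂ)).length → Fin N =>
        StrictMono n ∧ ∀ j, lo < (n j : ℕ) + 1),
      ∏ j : Fin (K.map fun p => ((p.1, p.2, 1) : ℕ × ℂ × ℂ)).length,
      ((K.map fun p => ((p.1, p.2, 1) : ℕ × ℂ × ℂ)).get j).2.1 ^ ((n j : ℕ) + 1) /
        ((((n j : ℕ) + 1 : ℕ) : ℂ) + ((K.map fun p => ((p.1, p.2, 1) : ℕ × ℂ × ℂ)).get j).2.2 - 1) ^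
          ((K.map fun p => ((p.1, p.2, 1) : ℕ × ℂ × ℂ)).get j).1
      = CP K lo (N + 1) := by
  induction K generalizing lo with
  | nil =>
    simp only [CP, List.map_nil, CL]
    show ∑ n ∈ Finset.univ.filter (fun n : Fin 0 → Fin N =>
        StrictMono n ∧ ∀ j, lo < (n j : ℕ) + 1), ∏ j : Fin 0, _ = _
    have : (Finset.univ.filter (fun n : Fin 0 → Fin N =>
        StrictMono n ∧ ∀ j, lo < (n j : ℕ) + 1)) = Finset.univ := by
      ext n; simp [Subsingleton.strictMono]
    rw [this]
    simp
  | cons a K ih =>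
    simp only [CP, List.map_cons, CL]
    set K' := K.map fun p => ((p.1, p.2, 1) : ℕ × ℂ × ℂ) with hK'
    have e1 : ∑ m ∈ Finset.Ioo (lo : ℤ) (N + 1), hh a m * CL (K.map hh) m (N + 1)
        = ∑ m : Fin N, if lo < (m : ℕ) + 1 then
            hh a ((m : ℕ) + 1 : ℕ) * CP K ((m : ℕ) + 1 : ℕ) (N + 1) else 0 := by
      rw [← Finset.sum_filter]
      symm
      refine Finset.sum_bij (fun m _ => (((m : ℕ) + 1 : ℕ) : ℤ)) ?_ ?_ ?_ ?_
      · intro m hm; simp at hm ⊢; omega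
      · intro m _ m' _ h; ext; simpa using h
      · intro b hb; simp only [Finset.mem_Ioo] at hb
        refine ⟨⟨(b - 1).toNat, by omega⟩, ?_, ?_⟩
        · simp; omega
        · simp; omega
      · intro m _; rfl
    rw [e1]
    simp_rw [← ih, Finset.mul_sum]
    rw [Finset.sum_filter]
    show ∑ n : Fin (K'.length + 1) → Fin N, _ = _
    rw [← (Fin.consEquiv (fun _ : Fin (K'.length + 1) => Fin N)).sum_comp, Fintype.sum_prod_type]
    refine Finset.sum_congr rfl fun m _ => ?_
    rw [← Finset.sum_filter]
    split_ifs with hm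
    · refine Finset.sum_congr ?_ ?_
      · ext n
        simp only [Finset.mem_filter, Finset.mem_univ, true_and, Fin.consEquiv_apply]
        show (StrictMono (Fin.cons m n : Fin (K'.length + 1) → Fin N) ∧
          ∀ j : Fin (K'.length + 1), lo < (((Fin.cons m n : Fin (K'.length + 1) → Fin N) j : Fin N) : ℕ) + 1) ↔ _
        rw [strictMono_cons_aux]
        constructor
        · rintro ⟨⟨h1, h2⟩, h3⟩
          exact ⟨h2, fun j => by have := h1 j; rw [Fin.lt_def] at this; omega⟩
        · rintro ⟨h1, h2⟩
          refine ⟨⟨fun j => ?_, h1⟩, fun j => ?_⟩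
          · have := h2 j; rw [Fin.lt_def]; omega
          · refine Fin.cases ?_ ?_ j
            · simpa using hm
            · intro j; have := h2 j; simp; omega
      · intro n _
        erw [Fin.prod_univ_succ]
        congr 1
        simp [hh]
        norm_cast
    · rw [Finset.filter_eq_empty_iff.2, Finset.sum_empty]
      intro n _ hn
      exact hm (by simpa using hn.2 (0 : Fin (K'.length + 1)))
where
  strictMono_cons_aux {n N : ℕ} {m : Fin N} {f : Fin n → Fin N} :
      StrictMono (Fin.cons m f : Fin (n+1) → Fin N) ↔ (∀ j, m < f j) ∧ StrictMono f := by
    constructor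
    · intro h
      refine ⟨fun j => ?_, fun i j hij => ?_⟩
      · simpa using h (Fin.succ_pos j)
      · simpa using h (Fin.succ_lt_succ_iff.2 hij)
    · rintro ⟨h1, h2⟩ i j
      refine Fin.cases ?_ ?_ i
      · refine Fin.cases ?_ ?_ j
        · simp
        · intro j _; simpa using h1 j
      · intro i
        refine Fin.cases ?_ ?_ j
        · simp
        · intro j hij; simpa using h2 (Fin.succ_lt_succ_iff.1 hij)

lemma cmhzP_eq (K : List (ℕ × ℂ)) (N : ℕ) :
    cmhzP (K.map fun p => (p.1, p.2, 1)) N = CP K 0 (N + 1) := by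
  rw [← Nat.cast_zero, ← cmhzP_aux]
  unfold cmhzP
  refine Finset.sum_congr ?_ (fun _ _ => rfl)
  ext n; simp

end SymC
namespace SymC

lemma hh_norm (p : ℕ × ℂ) (hp : ‖p.2‖ = 1) (m : ℤ) : ‖hh p m‖ = 1 / |(m : ℝ)| ^ p.1 := by
  simp only [hh, norm_div, norm_zpow, hp, one_zpow, norm_pow, Complex.norm_intCast]

lemma hh_norm_le (p : ℕ × ℂ) (hp : 0 < p.1 ∧ ‖p.2‖ = 1) (m : ℕ) :
    ‖hh p ((m : ℤ) + 1)‖ ≤ 1 / ((m : ℝ) + 1) := by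
  rw [hh_norm p hp.2]
  have : |(((m : ℤ) + 1 : ℤ) : ℝ)| = (m : ℝ) + 1 := by
    push_cast; exact abs_of_nonneg (by positivity)
  rw [this]
  apply one_div_le_one_div_of_le (by positivity)
  apply le_self_pow₀ _ hp.1.ne'
  have : (0 : ℝ) ≤ m := by positivity
  linarith

lemma Ioo_nat_succ (n t : ℕ) : Finset.Ioo (n : ℤ) ((n : ℤ) + 1 + (t + 1 : ℕ)) =
    insert ((n : ℤ) + 1 + t) (Finset.Ioo (n : ℤ) ((n : ℤ) + 1 + t)) := by
  ext x; simp; omega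

lemma tele_sum (n t : ℕ) :
    ∑ m ∈ Finset.Ioo (n : ℤ) ((n : ℤ) + 1 + t), 1 / ((m : ℝ) * (m + 1))
      = 1 / ((n : ℝ) + 1) - 1 / ((n : ℝ) + 1 + t) := by
  induction t with
  | zero =>
    have : Finset.Ioo (n : ℤ) ((n : ℤ) + 1 + (0 : ℕ)) = ∅ := by ext x; simp
    rw [this]; simp
  | succ t ih =>
    rw [Ioo_nat_succ, Finset.sum_insert (by simp), ih]
    push_cast
    field_simp
    ring

lemma tele_le (n : ℕ) (hi : ℤ) :
    ∑ m ∈ Finset.Ioo (n : ℤ) hi, 1 / ((m : ℝ) * (m + 1)) ≤ 1 / ((n : ℝ) + 1) := by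
  rcases le_or_gt hi (n + 1) with h | h
  · have : Finset.Ioo (n : ℤ) hi = ∅ := by ext x; simp; omega
    rw [this, Finset.sum_empty]; positivity
  · obtain ⟨t, ht⟩ := Int.eq_ofNat_of_zero_le (show 0 ≤ hi - (n + 1) by omega)
    have : hi = (n : ℤ) + 1 + t := by omega
    rw [this, tele_sum]
    have : (0 : ℝ) ≤ 1 / ((n : ℝ) + 1 + t) := by positivity
    linarith

lemma parts_bound (p : ℕ × ℂ) (hp : ‖p.2‖ = 1) (n t : ℕ) :
    ‖(1 - p.2) * ∑ m ∈ Finset.Ioo (n : ℤ) ((n : ℤ) + 1 + t), hh p m + hh p ((n : ℤ) + 1 + t)‖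
      ≤ 2 / ((n : ℝ) + 1) ^ p.1 - 1 / ((n : ℝ) + 1 + t) ^ p.1 := by
  have hx0 : p.2 ≠ 0 := by intro h; simp [h] at hp
  induction t with
  | zero =>
    have : Finset.Ioo (n : ℤ) ((n : ℤ) + 1 + (0 : ℕ)) = ∅ := by ext x; simp
    rw [this, Finset.sum_empty, mul_zero, zero_add, hh_norm p hp]
    have : |(((n : ℤ) + 1 + (0 : ℕ) : ℤ) : ℝ)| = (n : ℝ) + 1 := by
      push_cast; rw [add_zero]; exact abs_of_nonneg (by positivity)
    rw [this]
    simp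
    apply le_of_eq; ring
  | succ t ih =>
    rw [Ioo_nat_succ, Finset.sum_insert (by simp)]
    set S := ∑ m ∈ Finset.Ioo (n : ℤ) ((n : ℤ) + 1 + t), hh p m
    have key : (1 - p.2) * (hh p ((n : ℤ) + 1 + t) + S) + hh p ((n : ℤ) + 1 + (t + 1 : ℕ))
        = ((1 - p.2) * S + hh p ((n : ℤ) + 1 + t))
          - p.2 ^ ((n : ℤ) + 1 + t + 1) *
            ((1 / ((n : ℝ) + 1 + t) ^ p.1 - 1 / ((n : ℝ) + 1 + (t + 1 : ℕ)) ^ p.1 : ℝ) : ℂ) := by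
      simp only [hh]
      have e : (n : ℤ) + 1 + (t + 1 : ℕ) = (n : ℤ) + 1 + t + 1 := by push_cast; ring
      rw [e, zpow_add_one₀ hx0]
      push_cast
      ring
    rw [key]
    refine (norm_sub_le _ _).trans ?_
    rw [norm_mul, norm_zpow, hp, one_zpow, one_mul, Complex.norm_real, Real.norm_of_nonneg]
    · linarith
    · rw [sub_nonneg]
      apply one_div_le_one_div_of_le (by positivity)
      apply pow_le_pow_left₀ (by positivity)
      push_cast; linarith

lemma single_bound (p : ℕ × ℂ) (hp : 0 < p.1 ∧ ‖p.2‖ = 1) (h1 : ¬(p.1 = 1 ∧ p.2 = 1)) :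
    ∃ C : ℝ, 0 ≤ C ∧ ∀ (n : ℕ) (hi : ℤ), ‖∑ m ∈ Finset.Ioo (n : ℤ) hi, hh p m‖ ≤ C / (n + 1) := by
  by_cases hx : p.2 = 1
  · have hk : 2 ≤ p.1 := by
      have : p.1 ≠ 1 := fun h => h1 ⟨h, hx⟩
      omega
    refine ⟨2, by norm_num, fun n hi => ?_⟩
    refine (norm_sum_le _ _).trans ?_
    have : ∀ m ∈ Finset.Ioo (n : ℤ) hi, ‖hh p m‖ ≤ 2 * (1 / ((m : ℝ) * (m + 1))) := by
      intro m hm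
      simp only [Finset.mem_Ioo] at hm
      have hm1 : (1 : ℝ) ≤ m := by
        have : 1 ≤ m := by omega
        exact_mod_cast this
      rw [hh_norm p hp.2, abs_of_nonneg (by linarith)]
      calc 1 / (m : ℝ) ^ p.1 ≤ 1 / (m : ℝ) ^ 2 :=
            one_div_le_one_div_of_le (by positivity) (pow_le_pow_right₀ hm1 hk)
        _ ≤ _ := by
            rw [mul_one_div, div_le_div_iff₀ (by positivity) (by positivity)]
            nlinarith
    refine (Finset.sum_le_sum this).trans ?_
    rw [← Finset.mul_sum]
    have := tele_le n hi
    calc _ ≤ 2 * (1 / ((n : ℝ) + 1)) := by gcongr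
      _ = _ := by ring
  · have hx' : 0 < ‖1 - p.2‖ := norm_pos_iff.2 (sub_ne_zero.2 (Ne.symm hx))
    refine ⟨2 / ‖1 - p.2‖, by positivity, fun n hi => ?_⟩
    rcases le_or_gt hi (n + 1) with h | h
    · have : Finset.Ioo (n : ℤ) hi = ∅ := by ext x; simp; omega
      rw [this, Finset.sum_empty, norm_zero]; positivity
    · obtain ⟨t, ht⟩ := Int.eq_ofNat_of_zero_le (show 0 ≤ hi - (n + 1) by omega)
      have : hi = (n : ℤ) + 1 + t := by omega
      rw [this]
      have hb := parts_bound p hp.2 n t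
      set S := ∑ m ∈ Finset.Ioo (n : ℤ) ((n : ℤ) + 1 + t), hh p m
      have h2 : ‖hh p ((n : ℤ) + 1 + t)‖ = 1 / ((n : ℝ) + 1 + t) ^ p.1 := by
        rw [hh_norm p hp.2]; push_cast
        rw [abs_of_nonneg (by positivity)]
      have h3 : ‖(1 - p.2) * S‖ ≤ 2 / ((n : ℝ) + 1) ^ p.1 := by
        calc ‖(1 - p.2) * S‖ = ‖((1 - p.2) * S + hh p ((n : ℤ) + 1 + t)) - hh p ((n : ℤ) + 1 + t)‖ := by
              congr 1; ring
          _ ≤ _ := norm_sub_le _ _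
          _ ≤ _ := by rw [h2]; linarith
      have h4 : 2 / ((n : ℝ) + 1) ^ p.1 ≤ 2 / ((n : ℝ) + 1) := by
        apply div_le_div_of_nonneg_left (by norm_num) (by positivity)
        apply le_self_pow₀ _ hp.1.ne'
        have : (0 : ℝ) ≤ n := by positivity
        linarith
      rw [norm_mul] at h3
      rw [div_div, mul_comm, ← div_div, le_div_iff₀ hx', mul_comm]
      exact h3.trans h4

lemma single_tendsto (p : ℕ × ℂ) (hp : 0 < p.1 ∧ ‖p.2‖ = 1) (h1 : ¬(p.1 = 1 ∧ p.2 = 1)) (n : ℕ) :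
    ∃ l : ℂ, Tendsto (fun hi : ℤ => ∑ m ∈ Finset.Ioo (n : ℤ) hi, hh p m) atTop (nhds l) := by
  obtain ⟨C, hC0, hC⟩ := single_bound p hp h1
  have hc : CauchySeq (fun N : ℕ => ∑ m ∈ Finset.Ioo (n : ℤ) ((n : ℤ) + 1 + N), hh p m) := by
    refine cauchySeq_of_le_tendsto_0 (fun N : ℕ => C / ((N : ℝ) + 1)) ?_ ?_
    · have key : ∀ a b N : ℕ, N ≤ a → a ≤ b →
          dist (∑ m ∈ Finset.Ioo (n : ℤ) ((n : ℤ) + 1 + a), hh p m)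
            (∑ m ∈ Finset.Ioo (n : ℤ) ((n : ℤ) + 1 + b), hh p m) ≤ C / ((N : ℝ) + 1) := by
        intro a b N hN hab
        have : Finset.Ioo (n : ℤ) ((n : ℤ) + 1 + b) = Finset.Ioo (n : ℤ) ((n : ℤ) + 1 + a) ∪
            Finset.Ioo ((n + a : ℕ) : ℤ) ((n : ℤ) + 1 + b) := by
          ext x; simp; omega
        rw [this, Finset.sum_union, dist_comm, dist_eq_norm, add_sub_cancel_left]
        · refine (hC _ _).trans ?_
          apply div_le_div_of_nonneg_left hC0 (by positivity)
          have : (N : ℝ) ≤ a := by exact_mod_cast hN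
          have : (0 : ℝ) ≤ n := by positivity
          push_cast; linarith
        · rw [Finset.disjoint_left]; intro x; simp; omega
      intro a b N ha hb
      rcases le_total a b with h | h
      · exact key a b N ha h
      · rw [dist_comm]; exact key b a N hb h
    · simpa using (tendsto_one_div_add_atTop_nhds_zero_nat (𝕜 := ℝ)).const_mul C |>.congr
        (fun N => by ring)
  obtain ⟨l, hl⟩ := cauchySeq_tendsto_of_complete hc
  refine ⟨l, ?_⟩
  have ht : Tendsto (fun hi : ℤ => (hi - (n + 1)).toNat) atTop atTop := by
    refine tendsto_atTop.2 fun b => ?_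
    filter_upwards [eventually_ge_atTop ((n : ℤ) + 1 + b)] with hi h
    omega
  refine (hl.comp ht).congr' ?_
  filter_upwards [eventually_ge_atTop ((n : ℤ) + 1)] with hi h
  simp only [Function.comp]
  congr 2
  omega

lemma summ_aux (n0 : ℕ) : Summable (fun t : ℕ => 1 / (((n0 + t : ℕ) : ℝ) + 1) ^ 2) := by
  have h := (summable_nat_add_iff (f := fun t : ℕ => 1 / ((t : ℝ)) ^ 2) (n0 + 1)).2
    (Real.summable_one_div_nat_pow.2 (by norm_num))
  refine h.congr fun t => ?_
  push_cast; ring_nf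

/-- domination -/
lemma dom_aux (p : ℕ × ℂ) (hp : 0 < p.1 ∧ ‖p.2‖ = 1) (C : ℝ) (hC0 : 0 ≤ C) (n0 t : ℕ) (z : ℂ)
    (hz : ‖z‖ ≤ C / (((n0 + t + 1 : ℕ) : ℝ) + 1)) :
    ‖hh p (((n0 + t : ℕ) : ℤ) + 1) * z‖ ≤ C * (1 / (((n0 + t : ℕ) : ℝ) + 1) ^ 2) := by
  rw [norm_mul]
  have h1 := hh_norm_le p hp (n0 + t)
  have h2 : ‖z‖ ≤ C / (((n0 + t : ℕ) : ℝ) + 1) := by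
    refine hz.trans ?_
    apply div_le_div_of_nonneg_left hC0 (by positivity)
    push_cast; linarith
  calc _ ≤ (1 / (((n0 + t : ℕ) : ℝ) + 1)) * (C / (((n0 + t : ℕ) : ℝ) + 1)) := by
        gcongr
    _ = _ := by field_simp

lemma tannery {ι : Type*} (l : Filter ι) (p : ℕ × ℂ) (hp : 0 < p.1 ∧ ‖p.2‖ = 1) (C : ℝ)
    (hC0 : 0 ≤ C) (n0 : ℕ) (u : ι → ℕ → ℂ) (L : ℕ → ℂ)
    (hu : ∀ i n, ‖u i n‖ ≤ C / ((n : ℝ) + 1))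
    (hL : ∀ n, Tendsto (fun i => u i n) l (nhds (L n))) :
    Tendsto (fun i => ∑' t : ℕ, hh p (((n0 + t : ℕ) : ℤ) + 1) * u i (n0 + t + 1)) l
      (nhds (∑' t : ℕ, hh p (((n0 + t : ℕ) : ℤ) + 1) * L (n0 + t + 1))) := by
  refine tendsto_tsum_of_dominated_convergence
    (bound := fun t : ℕ => C * (1 / (((n0 + t : ℕ) : ℝ) + 1) ^ 2))
    ((summ_aux n0).mul_left C) ?_ ?_
  · intro t; exact (hL _).const_mul _
  · filter_upwards with i t
    exact dom_aux p hp C hC0 n0 t _ (hu i _)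

lemma CP_cons_tsum (p : ℕ × ℂ) (K : List (ℕ × ℂ)) (hK : K ≠ []) (n0 : ℕ) (hi : ℤ) :
    CP (p :: K) n0 hi = ∑' t : ℕ, hh p (((n0 + t : ℕ) : ℤ) + 1) * CP K ((n0 + t + 1 : ℕ) : ℤ) hi := by
  rw [tsum_eq_sum (s := Finset.range (hi - (n0 + 1)).toNat)]
  · simp only [CP, List.map_cons, CL]
    symm
    refine Finset.sum_bij (fun t _ => (((n0 + t : ℕ) : ℤ) + 1)) ?_ ?_ ?_ ?_
    · intro t ht; simp at ht ⊢; omega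
    · intro a _ b _ h; omega
    · intro b hb; simp only [Finset.mem_Ioo] at hb
      exact ⟨(b - (n0 + 1)).toNat, by simp; omega, by push_cast; omega⟩
    · intro t _; push_cast; rfl
  · intro t ht
    simp only [Finset.mem_range, not_lt] at ht
    rw [CP, CL_empty _ (by simpa using hK), mul_zero]
    push_cast; omega

def Adm (K : List (ℕ × ℂ)) : Prop :=
  (∀ p ∈ K, 0 < p.1 ∧ ‖p.2‖ = 1) ∧ ∀ p ∈ K.getLast?, ¬(p.1 = 1 ∧ p.2 = 1)

lemma Adm.tail {p : ℕ × ℂ} {K : List (ℕ × ℂ)} (hK : K ≠ []) (h : Adm (p :: K)) : Adm K := by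
  refine ⟨fun q hq => h.1 q (by simp [hq]), fun q hq => h.2 q ?_⟩
  cases K with
  | nil => exact absurd rfl hK
  | cons a K => simpa [List.getLast?_cons_cons] using hq

lemma CP_main (K : List (ℕ × ℂ)) (hK : K ≠ []) (hA : Adm K) :
    ∃ C : ℝ, 0 ≤ C ∧ (∀ (n : ℕ) (hi : ℤ), ‖CP K n hi‖ ≤ C / ((n : ℝ) + 1)) ∧
      ∃ L : ℕ → ℂ, ∀ n : ℕ, Tendsto (fun hi : ℤ => CP K n hi) atTop (nhds (L n)) := by
  induction K with
  | nil => exact absurd rfl hK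
  | cons p K ih =>
    have hp := hA.1 p (by simp)
    by_cases hK' : K = []
    · subst hK'
      have h1 := hA.2 p (by simp)
      obtain ⟨C, hC0, hC⟩ := single_bound p hp h1
      choose L hL using single_tendsto p hp h1
      refine ⟨C, hC0, fun n hi => ?_, L, fun n => ?_⟩
      · simpa [CP, CL] using hC n hi
      · simpa [CP, CL] using hL n
    · obtain ⟨C, hC0, hC, L, hL⟩ := ih hK' (hA.tail hK')
      refine ⟨C, hC0, fun n hi => ?_, fun n0 => ∑' t : ℕ, hh p (((n0 + t : ℕ) : ℤ) + 1) * L (n0 + t + 1),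
        fun n0 => ?_⟩
      · simp only [CP, List.map_cons, CL]
        refine (norm_sum_le _ _).trans ?_
        calc _ ≤ ∑ m ∈ Finset.Ioo (n : ℤ) hi, C * (1 / ((m : ℝ) * (m + 1))) := by
              refine Finset.sum_le_sum fun m hm => ?_
              simp only [Finset.mem_Ioo] at hm
              obtain ⟨t, ht⟩ := Int.eq_ofNat_of_zero_le (show 0 ≤ m - 1 by omega)
              have : m = (t : ℤ) + 1 := by omega
              subst this
              rw [norm_mul]
              have h1 := hh_norm_le p hp t
              have h2 := hC (t + 1) hi
              rw [CP] at h2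
              push_cast at h2 ⊢
              calc _ ≤ (1 / ((t : ℝ) + 1)) * (C / ((t : ℝ) + 1 + 1)) := by gcongr
                _ = _ := by field_simp
          _ ≤ _ := by
              rw [← Finset.mul_sum]
              have := tele_le n hi
              calc _ ≤ C * (1 / ((n : ℝ) + 1)) := by gcongr
                _ = _ := by ring
      · simp_rw [CP_cons_tsum p K hK']
        exact tannery atTop p hp C hC0 n0 (fun hi n => CP K (n : ℤ) hi) L (fun i n => hC n i) hL

lemma tendsto_natz : Tendsto (fun N : ℕ => (N : ℤ) + 1) atTop atTop :=
  tendsto_atTop_add_const_right _ _ tendsto_natCast_atTop_atTop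

lemma CP_tendsto (K : List (ℕ × ℂ)) (hA : Adm K) :
    Tendsto (fun N : ℕ => CP K 0 ((N : ℤ) + 1)) atTop (nhds (cmzv K)) := by
  have : ∃ l, Tendsto (fun N : ℕ => CP K 0 ((N : ℤ) + 1)) atTop (nhds l) := by
    by_cases hK : K = []
    · subst hK; exact ⟨1, by simp [CP, CL]⟩
    · obtain ⟨C, _, _, L, hL⟩ := CP_main K hK hA
      exact ⟨L 0, (hL 0).comp tendsto_natz⟩
  obtain ⟨l, hl⟩ := this
  have : cmzv K = l := by
    unfold cmzv cmhz
    apply Tendsto.limUnder_eq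
    exact hl.congr (fun N => (cmhzP_eq K N).symm)
  rw [this]; exact hl

/-- special sums -/
lemma Splus_tendsto (p : ℕ × ℂ) (K : List (ℕ × ℂ)) (hK : K ≠ []) (hA : Adm (p :: K)) :
    Tendsto (fun N : ℕ => ∑' t : ℕ, hh p ((t : ℤ) + 1) * CP K ((t : ℤ) + 1) ((t : ℤ) + 1 + (N + 1)))
      atTop (nhds (cmzv (p :: K))) := by
  have hp := hA.1 p (by simp)
  obtain ⟨C, hC0, hC, L, hL⟩ := CP_main K hK (hA.tail hK)
  have h1 := tannery atTop p hp C hC0 0 (fun (N : ℕ) n => CP K (n : ℤ) ((N : ℤ) + 1)) L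
    (fun i n => hC n _) (fun n => (hL n).comp tendsto_natz)
  have h2 := tannery atTop p hp C hC0 0 (fun (N : ℕ) n => CP K (n : ℤ) ((n : ℤ) + (N + 1))) L
    (fun i n => hC n _) (fun n => (hL n).comp (tendsto_atTop_add_const_left _ _ tendsto_natz))
  have h3 := CP_tendsto (p :: K) hA
  have h4 : (fun N : ℕ => CP (p :: K) 0 ((N : ℤ) + 1)) = fun (N : ℕ) =>
      ∑' t : ℕ, hh p (((0 + t : ℕ) : ℤ) + 1) * CP K ((0 + t + 1 : ℕ) : ℤ) ((N : ℤ) + 1) := by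
    funext N
    have := CP_cons_tsum p K hK 0 ((N : ℤ) + 1)
    simpa using this
  rw [h4] at h3
  rw [tendsto_nhds_unique h3 h1]
  simpa using h2

lemma Splus_trunc (p : ℕ × ℂ) (K : List (ℕ × ℂ)) (hK : K ≠ []) (hA : Adm (p :: K)) (hi : ℤ)
    (u : ℕ → ℕ → ℤ) (hu : ∀ n, ∀ᶠ M in atTop, u M n = (n : ℤ) + 1 + hi) :
    Tendsto (fun M : ℕ => ∑ t ∈ Finset.range M, hh p ((t : ℤ) + 1) * CP K ((t : ℤ) + 1) (u M t)) atTop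
      (nhds (∑' t : ℕ, hh p ((t : ℤ) + 1) * CP K ((t : ℤ) + 1) ((t : ℤ) + 1 + hi))) := by
  have hp := hA.1 p (by simp)
  obtain ⟨C, hC0, hC, L, hL⟩ := CP_main K hK (hA.tail hK)
  have h1 := tannery atTop p hp C hC0 0
    (fun (M : ℕ) n => if n - 1 < M then CP K (n : ℤ) (u M (n - 1)) else 0)
    (fun n => CP K (n : ℤ) (((n - 1 : ℕ) : ℤ) + 1 + hi))
    (fun i n => by
      split_ifs
      · exact hC n _
      · rw [norm_zero]; positivity)
    (fun n => by
      refine tendsto_const_nhds.congr' ?_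
      filter_upwards [hu (n - 1), eventually_gt_atTop (n - 1)] with M h1 h2
      rw [if_pos h2, h1])
  simp only [zero_add, Nat.add_sub_cancel] at h1
  push_cast at h1
  refine h1.congr fun M => ?_
  rw [tsum_eq_sum (s := Finset.range M)]
  · refine Finset.sum_congr rfl fun t ht => ?_
    rw [if_pos (by simpa using ht)]
  · intro t ht
    rw [if_neg (by simpa using ht), mul_zero]

end SymC
namespace SymC

def AS (u : ℕ → ℂ) (s : ℂ) : Prop :=
  (∀ ρ : ℝ, 0 < ρ → ρ < 1 → Summable (fun n => u n * (ρ : ℂ) ^ n)) ∧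
  Tendsto (fun ρ : ℝ => (1 - (ρ : ℂ)) * ∑' n, u n * (ρ : ℂ) ^ n) (nhdsWithin 1 (Set.Iio 1)) (nhds s)

lemma ev_Ioo : ∀ᶠ ρ : ℝ in nhdsWithin 1 (Set.Iio 1), 0 < ρ ∧ ρ < 1 := by
  have := Ioo_mem_nhdsLT (show (0 : ℝ) < 1 by norm_num)
  filter_upwards [this] with ρ h using h

lemma AS.add {u v : ℕ → ℂ} {s t : ℂ} (hu : AS u s) (hv : AS v t) : AS (fun n => u n + v n) (s + t) := by
  refine ⟨fun ρ h0 h1 => ?_, ?_⟩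
  · simpa only [add_mul] using (hu.1 ρ h0 h1).add (hv.1 ρ h0 h1)
  · refine (hu.2.add hv.2).congr' ?_
    filter_upwards [ev_Ioo] with ρ h
    simp only [add_mul]
    rw [(hu.1 ρ h.1 h.2).tsum_add (hv.1 ρ h.1 h.2)]
    ring

lemma AS.const_mul {u : ℕ → ℂ} {s : ℂ} (c : ℂ) (hu : AS u s) : AS (fun n => c * u n) (c * s) := by
  refine ⟨fun ρ h0 h1 => ?_, ?_⟩
  · simpa only [mul_assoc] using (hu.1 ρ h0 h1).mul_left c
  · refine (hu.2.const_mul c).congr' ?_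
    filter_upwards [ev_Ioo] with ρ h
    simp only [mul_assoc]
    rw [tsum_mul_left]
    ring

lemma AS.zero : AS (fun _ => 0) 0 := by
  refine ⟨fun ρ h0 h1 => by simp, by simp⟩

lemma AS.sum {ι : Type*} (S : Finset ι) (u : ι → ℕ → ℂ) (s : ι → ℂ) (h : ∀ i ∈ S, AS (u i) (s i)) :
    AS (fun n => ∑ i ∈ S, u i n) (∑ i ∈ S, s i) := by
  classical
  induction S using Finset.induction_on with
  | empty => simpa using AS.zero
  | insert a S ha ih =>
    simp only [Finset.sum_insert ha]
    exact (h a (by simp)).add (ih fun i hi => h i (by simp [hi]))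

lemma AS.unique {u : ℕ → ℂ} {s t : ℂ} (hu : AS u s) (hv : AS u t) : s = t :=
  tendsto_nhds_unique hu.2 hv.2

lemma bdd_summable (a : ℕ → ℂ) (C : ℝ) (hC : ∀ n, ‖a n‖ ≤ C) (ρ : ℝ) (h0 : 0 < ρ) (h1 : ρ < 1) :
    Summable (fun n => ‖a n * (ρ : ℂ) ^ n‖) := by
  refine Summable.of_nonneg_of_le (fun _ => norm_nonneg _) (fun n => ?_)
    ((summable_geometric_of_lt_one h0.le h1).mul_left C)
  rw [norm_mul, norm_pow, Complex.norm_real, Real.norm_of_nonneg h0.le]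
  gcongr
  exact hC n

lemma conv_tsum (a b : ℕ → ℂ) (C D : ℝ) (hC : ∀ n, ‖a n‖ ≤ C) (hD : ∀ n, ‖b n‖ ≤ D) (ρ : ℝ)
    (h0 : 0 < ρ) (h1 : ρ < 1) :
    Summable (fun N => (∑ x ∈ Finset.HasAntidiagonal.antidiagonal N, a x.1 * b x.2) * (ρ : ℂ) ^ N) ∧
    ∑' N, (∑ x ∈ Finset.HasAntidiagonal.antidiagonal N, a x.1 * b x.2) * (ρ : ℂ) ^ N =
      (∑' n, a n * (ρ : ℂ) ^ n) * ∑' n, b n * (ρ : ℂ) ^ n := by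
  have ha := bdd_summable a C hC ρ h0 h1
  have hb := bdd_summable b D hD ρ h0 h1
  have e : ∀ N, ∑ x ∈ Finset.HasAntidiagonal.antidiagonal N, (a x.1 * (ρ : ℂ) ^ x.1) * (b x.2 * (ρ : ℂ) ^ x.2)
      = (∑ x ∈ Finset.HasAntidiagonal.antidiagonal N, a x.1 * b x.2) * (ρ : ℂ) ^ N := by
    intro N
    rw [Finset.sum_mul]
    refine Finset.sum_congr rfl fun x hx => ?_
    rw [← Finset.HasAntidiagonal.mem_antidiagonal.1 hx, pow_add]; ring
  constructor
  · have := (summable_norm_sum_mul_antidiagonal_of_summable_norm ha hb).of_norm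
    simpa only [e] using this
  · rw [tsum_mul_tsum_eq_tsum_sum_antidiagonal_of_summable_norm ha hb]
    simp only [e]

lemma bdd_of_tendsto (B : ℕ → ℂ) (t : ℂ) (hB : Tendsto B atTop (nhds t)) : ∃ D, ∀ n, ‖B n‖ ≤ D := by
  obtain ⟨D, hD⟩ := (Metric.isBounded_range_of_tendsto B hB).exists_norm_le
  exact ⟨D, fun n => hD _ ⟨n, rfl⟩⟩

lemma bdd_of_partial (a : ℕ → ℂ) (s : ℂ)
    (ha : Tendsto (fun N => ∑ n ∈ Finset.range N, a n) atTop (nhds s)) : ∃ D, ∀ n, ‖a n‖ ≤ D := by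
  have h2 : Tendsto a atTop (nhds (s - s)) := by
    refine ((ha.comp (tendsto_add_atTop_nat 1)).sub ha).congr fun n => ?_
    simp [Finset.sum_range_succ]
  exact bdd_of_tendsto _ _ h2

lemma AS_conv (a B : ℕ → ℂ) (s t : ℂ)
    (ha : Tendsto (fun N => ∑ n ∈ Finset.range N, a n) atTop (nhds s))
    (hB : Tendsto B atTop (nhds t)) :
    AS (fun N => ∑ x ∈ Finset.HasAntidiagonal.antidiagonal N, a x.1 * B x.2) (s * t) := by
  obtain ⟨C, hC⟩ := bdd_of_partial a s ha
  obtain ⟨D, hD⟩ := bdd_of_tendsto B t hB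
  let b : ℕ → ℂ := fun n => Nat.casesOn n (B 0) (fun m => B (m + 1) - B m)
  have hb : ∀ N, ∑ n ∈ Finset.range (N + 1), b n = B N := by
    intro N
    induction N with
    | zero => simp [b]
    | succ N ih => rw [Finset.sum_range_succ, ih]; simp [b]
  have hbt : Tendsto (fun N => ∑ n ∈ Finset.range N, b n) atTop (nhds t) := by
    rw [← tendsto_add_atTop_iff_nat 1]
    simpa only [hb] using hB
  obtain ⟨D', hD'⟩ := bdd_of_partial b t hbt
  refine ⟨fun ρ h0 h1 => (conv_tsum a B C D hC hD ρ h0 h1).1, ?_⟩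
  have l1 := Complex.tendsto_tsum_powerSeries_nhdsWithin_lt ha
  have l2 := Complex.tendsto_tsum_powerSeries_nhdsWithin_lt hbt
  rw [tendsto_map'_iff] at l1 l2
  refine (l1.mul l2).congr' ?_
  filter_upwards [ev_Ioo] with ρ h
  simp only [Function.comp]
  rw [(conv_tsum a B C D hC hD ρ h.1 h.2).2]
  have e1 := (conv_tsum b (fun _ => 1) D' 1 hD' (by simp) ρ h.1 h.2).2
  have e2 : ∀ N, ∑ x ∈ Finset.HasAntidiagonal.antidiagonal N, b x.1 * (fun _ => (1 : ℂ)) x.2 = B N := by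
    intro N
    simp only [mul_one]
    rw [Finset.Nat.sum_antidiagonal_eq_sum_range_succ_mk]
    exact hb N
  simp only [e2, one_mul] at e1
  rw [e1, tsum_geometric_of_norm_lt_one]
  · have : (1 - (ρ : ℂ)) ≠ 0 := by
      rw [sub_ne_zero]; exact_mod_cast h.2.ne'
    field_simp
  · rw [Complex.norm_real, Real.norm_of_nonneg h.1.le]; exact h.2

lemma AS_of_tendsto (B : ℕ → ℂ) (t : ℂ) (hB : Tendsto B atTop (nhds t)) : AS B t := by
  have := AS_conv (fun n => if n = 0 then 1 else 0) B 1 t ?_ hB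
  · simp only [one_mul] at this
    convert this using 2 with N
    rw [Finset.sum_eq_single (0, N)]
    · simp
    · rintro ⟨p, q⟩ h1 h2
      simp only [Finset.HasAntidiagonal.mem_antidiagonal] at h1
      have : p ≠ 0 := by rintro rfl; simp at h1; exact h2 (by simp [h1])
      simp [this]
    · simp
  · refine tendsto_const_nhds.congr' ?_
    filter_upwards [eventually_gt_atTop 0] with N hN
    simp [Finset.sum_ite_eq', hN]

end SymC
namespace SymC

lemma CP_tendstoZ (K : List (ℕ × ℂ)) (hA : Adm K) :
    Tendsto (fun hi : ℤ => CP K 0 hi) atTop (nhds (cmzv K)) := by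
  by_cases hK : K = []
  · subst hK
    have h := CP_tendsto [] hA
    have : cmzv [] = 1 := tendsto_nhds_unique h (by simp [CP, CL])
    simp [this, CP, CL]
  · obtain ⟨C, _, _, L, hL⟩ := CP_main K hK hA
    have h1 := (hL 0).comp tendsto_natz
    rw [tendsto_nhds_unique (CP_tendsto K hA) h1]
    exact hL 0

lemma hh_neg (p : ℕ × ℂ) (m : ℤ) : hh p (-m) = (-1) ^ p.1 * hh (p.1, p.2⁻¹) m := by
  simp only [hh, zpow_neg, inv_zpow]
  push_cast
  rw [neg_pow, div_eq_mul_inv, div_eq_mul_inv, mul_inv]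
  have : ((-1 : ℂ) ^ p.1)⁻¹ = (-1) ^ p.1 := by
    rw [← inv_pow]; norm_num
  rw [this]; ring

lemma hh_zero (p : ℕ × ℂ) (hp : 0 < p.1) : hh p 0 = 0 := by
  simp [hh, hp.ne']

lemma two_sided (X : ℂ) (hX : ‖X‖ = 1) (hX1 : X ≠ 1) (t : ℕ) (ht : 1 ≤ t) (q : ℤ) :
    Tendsto (fun N : ℕ => ∑ n ∈ Finset.Icc (-(N : ℤ)) N, X ^ n * (((n : ℂ) - q)⁻¹) ^ t) atTop
      (nhds (X ^ q * ((-1 : ℂ) ^ t * li1 t X⁻¹ + li1 t X))) := by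
  have hX0 : X ≠ 0 := by intro h; simp [h] at hX
  have hXi : ‖X⁻¹‖ = 1 := by simp [hX]
  have hX1i : X⁻¹ ≠ 1 := by simpa using hX1
  have A1 : Adm [(t, X)] := ⟨by simp [hX]; omega, by simp [hX1]⟩
  have A2 : Adm [(t, X⁻¹)] := ⟨by simp [hX]; omega, by simp [hX1]⟩
  have l1 := CP_tendstoZ _ A1
  have l2 := CP_tendstoZ _ A2
  have t1 : Tendsto (fun N : ℕ => (N : ℤ) + (1 - q)) atTop atTop :=
    tendsto_atTop_add_const_right _ _ tendsto_natCast_atTop_atTop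
  have t2 : Tendsto (fun N : ℕ => (N : ℤ) + (1 + q)) atTop atTop :=
    tendsto_atTop_add_const_right _ _ tendsto_natCast_atTop_atTop
  have := ((((l2.comp t2).const_mul ((-1 : ℂ) ^ t)).add (l1.comp t1))).const_mul (X ^ q)
  refine this.congr' ?_
  filter_upwards [eventually_ge_atTop q.natAbs] with N hN
  simp only [Function.comp, CP, List.map_cons, List.map_nil, CL, mul_one]
  have e1 : ∑ n ∈ Finset.Icc (-(N : ℤ)) N, X ^ n * (((n : ℂ) - q)⁻¹) ^ t =
      ∑ m ∈ Finset.Icc (-(N : ℤ) - q) (N - q), X ^ q * hh (t, X) m := by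
    refine Finset.sum_bij (fun n _ => n - q) ?_ ?_ ?_ ?_
    · intro a; simp
    · intro a _ b _; simp
    · intro b hb; refine ⟨b + q, ?_, by ring⟩
      simp only [Finset.mem_Icc] at *; omega
    · intro n _
      simp only [hh]
      rw [zpow_sub₀ hX0]
      have : X ^ q ≠ 0 := zpow_ne_zero _ hX0
      push_cast
      rw [inv_pow]
      field_simp
  rw [e1, ← Finset.mul_sum]
  congr 1
  have e2 : Finset.Icc (-(N : ℤ) - q) (N - q) =
      (Finset.Ioo (-((N : ℤ) + (1 + q))) 0 ∪ {0}) ∪ Finset.Ioo 0 ((N : ℤ) + (1 - q)) := by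
    ext x; simp; omega
  rw [e2, Finset.sum_union, Finset.sum_union, Finset.sum_singleton, hh_zero _ (by simp; omega), add_zero]
  · congr 1
    rw [Finset.mul_sum]
    refine Finset.sum_bij (fun m _ => -m) ?_ ?_ ?_ ?_
    · intro a; simp; omega
    · intro a _ b _; simp
    · intro b hb; refine ⟨-b, ?_, by ring⟩
      simp only [Finset.mem_Ioo] at *; omega
    · intro m _; rw [hh_neg]
  · rw [Finset.disjoint_left]; intro x; simp; omega
  · rw [Finset.disjoint_left]; intro x; simp; omega

noncomputable def iv (a : ℂ) : PowerSeries ℂ := (PowerSeries.C a + PowerSeries.X)⁻¹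

lemma iv_mul (a : ℂ) (ha : a ≠ 0) : (PowerSeries.C a + PowerSeries.X) * iv a = 1 := by
  apply PowerSeries.mul_inv_cancel
  simpa using ha

noncomputable def ev (E : ℕ → ℂ) (K : ℕ) (B : PowerSeries ℂ) : ℂ :=
  ∑ i ∈ Finset.range (K + 1), E i * PowerSeries.coeff (K - i) B

lemma ev_add (E : ℕ → ℂ) (K : ℕ) (A B : PowerSeries ℂ) : ev E K (A + B) = ev E K A + ev E K B := by
  simp [ev, mul_add, Finset.sum_add_distrib]

lemma ev_sub (E : ℕ → ℂ) (K : ℕ) (A B : PowerSeries ℂ) : ev E K (A - B) = ev E K A - ev E K B := by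
  simp [ev, mul_sub, Finset.sum_sub_distrib]

lemma ev_C (E : ℕ → ℂ) (K : ℕ) (c : ℂ) (B : PowerSeries ℂ) :
    ev E K (PowerSeries.C c * B) = c * ev E K B := by
  simp only [ev, PowerSeries.coeff_C_mul, Finset.mul_sum]
  refine Finset.sum_congr rfl fun i _ => by ring

lemma ev_X (E : ℕ → ℂ) (K : ℕ) (B : PowerSeries ℂ) :
    ev E (K + 1) (PowerSeries.X * B) = ev E K B := by
  unfold ev
  rw [Finset.sum_range_succ]
  simp only [Nat.sub_self, PowerSeries.coeff_zero_X_mul, mul_zero, add_zero]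
  refine Finset.sum_congr rfl fun i hi => ?_
  simp only [Finset.mem_range] at hi
  rw [show K + 1 - i = (K - i) + 1 by omega, PowerSeries.coeff_succ_X_mul]

lemma prod_upd {ι M : Type*} [DecidableEq ι] [CommMonoid M] (S : Finset ι) (y : ι → M) (k : ι → ℕ)
    (b : ι) (hb : b ∈ S) (hk : 0 < k b) :
    ∏ l ∈ S, y l ^ k l = y b * ∏ l ∈ S, y l ^ (Function.update k b (k b - 1)) l := by
  rw [← Finset.mul_prod_erase S _ hb, ← Finset.mul_prod_erase S _ hb, ← mul_assoc]
  congr 1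
  · rw [Function.update_self, ← pow_succ', Nat.sub_add_cancel hk]
  · refine Finset.prod_congr rfl fun l hl => ?_
    rw [Function.update_of_ne (Finset.ne_of_mem_erase hl)]

lemma prod_upd' {ι M : Type*} [DecidableEq ι] [CommMonoid M] (S : Finset ι) (y : ι → M) (k : ι → ℕ)
    (b : ι) (v : ℕ) (hb : b ∉ S) :
    ∏ l ∈ S, y l ^ (Function.update k b v) l = ∏ l ∈ S, y l ^ k l := by
  refine Finset.prod_congr rfl fun l hl => ?_
  rw [Function.update_of_ne (by rintro rfl; exact hb hl)]

noncomputable def Bq {ι : Type*} [Fintype ι] [DecidableEq ι] (p : ι → ℤ) (k : ι → ℕ) (l : ι) :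
    PowerSeries ℂ := ∏ l' ∈ Finset.univ.erase l, iv ((p l : ℂ) - p l') ^ k l'

lemma Bq_upd {ι : Type*} [Fintype ι] [DecidableEq ι] (p : ι → ℤ) (hp : Function.Injective p)
    (k : ι → ℕ) (l b : ι) (hlb : b ≠ l) (hk : 0 < k b) :
    Bq p (Function.update k b (k b - 1)) l =
      PowerSeries.C ((p l : ℂ) - p b) * Bq p k l + PowerSeries.X * Bq p k l := by
  have h : (p l : ℂ) - p b ≠ 0 := by
    rw [sub_ne_zero]; exact_mod_cast fun h => hlb (hp h).symm
  rw [← add_mul]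
  have e : Bq p k l = iv ((p l : ℂ) - p b) * Bq p (Function.update k b (k b - 1)) l :=
    prod_upd _ _ k b (by simp [hlb]) hk
  rw [e, ← mul_assoc, iv_mul _ h, one_mul]

lemma Bq_upd_self {ι : Type*} [Fintype ι] [DecidableEq ι] (p : ι → ℤ)
    (k : ι → ℕ) (l : ι) (v : ℕ) : Bq p (Function.update k l v) l = Bq p k l :=
  prod_upd' _ _ k l v (by simp)

noncomputable def Tq {ι : Type*} [Fintype ι] [DecidableEq ι] (E : ℕ → ℂ) (p : ι → ℤ) (k : ι → ℕ)
    (l : ι) : ℂ := ev E (k l) (Bq p k l)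

lemma Tq_rec {ι : Type*} [Fintype ι] [DecidableEq ι] (E : ℕ → ℂ) (p : ι → ℤ)
    (hp : Function.Injective p) (k : ι → ℕ) (a b : ι) (hab : a ≠ b) (ha : 0 < k a) (hb : 0 < k b)
    (l : ι) :
    Tq E p (Function.update k b (k b - 1)) l - Tq E p (Function.update k a (k a - 1)) l
      = ((p a : ℂ) - p b) * Tq E p k l := by
  unfold Tq
  by_cases hla : l = a
  · subst hla
    rw [Function.update_self, Function.update_of_ne hab, Bq_upd p hp k l b hab.symm hb, Bq_upd_self,
      ← ev_X E (k l - 1), Nat.sub_add_cancel ha, ev_add, ev_C]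
    ring
  by_cases hlb : l = b
  · subst hlb
    rw [Function.update_self, Function.update_of_ne hab.symm, Bq_upd p hp k l a hab ha, Bq_upd_self,
      ← ev_X E (k l - 1), Nat.sub_add_cancel hb, ev_add, ev_C]
    ring
  rw [Function.update_of_ne hla, Function.update_of_ne hlb, Bq_upd p hp k l a (Ne.symm hla) ha,
    Bq_upd p hp k l b (Ne.symm hlb) hb, ev_add, ev_add, ev_C, ev_C]
  ring

open scoped Classical in
noncomputable def gq {ι : Type*} [Fintype ι] (X : ℂ) (p : ι → ℤ) (k : ι → ℕ) (n : ℤ) : ℂ :=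
  if ∃ l, n = p l then 0 else X ^ n * ∏ l, (((n : ℂ) - p l)⁻¹) ^ k l

lemma gq_rec {ι : Type*} [Fintype ι] [DecidableEq ι] (X : ℂ) (p : ι → ℤ)
    (k : ι → ℕ) (a b : ι) (ha : 0 < k a) (hb : 0 < k b) (n : ℤ) :
    gq X p (Function.update k b (k b - 1)) n - gq X p (Function.update k a (k a - 1)) n
      = ((p a : ℂ) - p b) * gq X p k n := by
  unfold gq
  split_ifs with h
  · simp
  · push Not at h
    have na : (n : ℂ) - p a ≠ 0 := by rw [sub_ne_zero]; exact_mod_cast h a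
    have nb : (n : ℂ) - p b ≠ 0 := by rw [sub_ne_zero]; exact_mod_cast h b
    have ea := prod_upd Finset.univ (fun l => ((n : ℂ) - p l)⁻¹) k a (Finset.mem_univ _) ha
    have eb := prod_upd Finset.univ (fun l => ((n : ℂ) - p l)⁻¹) k b (Finset.mem_univ _) hb
    rw [inv_mul_eq_div, eq_div_iff na] at ea
    rw [inv_mul_eq_div, eq_div_iff nb] at eb
    rw [← ea, ← eb]
    ring

lemma PF {ι : Type*} [Fintype ι] [DecidableEq ι] (X : ℂ) (E : ℕ → ℂ) (hE0 : E 0 = -1)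
    (hE : ∀ t, 1 ≤ t → ∀ q : ℤ, Tendsto (fun N : ℕ => ∑ n ∈ Finset.Icc (-(N : ℤ)) N,
      X ^ n * (((n : ℂ) - q)⁻¹) ^ t) atTop (nhds (X ^ q * E t)))
    (p : ι → ℤ) (hp : Function.Injective p) (s : ℕ) (k : ι → ℕ) (hs : ∑ l, k l = s)
    (a : ι) (ha : 0 < k a) :
    Tendsto (fun N : ℕ => ∑ n ∈ Finset.Icc (-(N : ℤ)) N, gq X p k n) atTop
      (nhds (∑ l, X ^ p l * Tq E p k l)) := by
  induction s generalizing k a with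
  | zero =>
    have := Finset.single_le_sum (f := k) (fun _ _ => Nat.zero_le _) (Finset.mem_univ a)
    omega
  | succ s ih =>
    by_cases hu : ∃ b, b ≠ a ∧ 0 < k b
    · obtain ⟨b, hba, hb⟩ := hu
      have hsum : ∀ c, 0 < k c → ∑ l, Function.update k c (k c - 1) l = s := by
        intro c hc
        rw [← Finset.add_sum_erase _ _ (Finset.mem_univ c)] at hs
        rw [← Finset.add_sum_erase _ _ (Finset.mem_univ c), Function.update_self]
        have : ∑ l ∈ Finset.univ.erase c, Function.update k c (k c - 1) l =
            ∑ l ∈ Finset.univ.erase c, k l := Finset.sum_congr rfl fun l hl => by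
              rw [Function.update_of_ne (Finset.ne_of_mem_erase hl)]
        omega
      have h1 := ih (Function.update k b (k b - 1)) (hsum b hb) a
        (by rwa [Function.update_of_ne hba.symm])
      have h2 := ih (Function.update k a (k a - 1)) (hsum a ha) b
        (by rwa [Function.update_of_ne hba])
      have hne : ((p a : ℂ) - p b) ≠ 0 := by
        rw [sub_ne_zero]; exact_mod_cast fun h => hba (hp h).symm
      have h3 := (h1.sub h2).const_mul ((p a : ℂ) - p b)⁻¹
      simp only [← Finset.sum_sub_distrib, gq_rec X p k a b ha hb, ← mul_sub,
        Tq_rec E p hp k a b hba.symm ha hb] at h3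
      convert h3 using 2
      · rw [← Finset.mul_sum, inv_mul_cancel_left₀ hne]
      · rw [Finset.mul_sum]
        refine Finset.sum_congr rfl fun l _ => ?_
        field_simp
    · push Not at hu
      have hk0 : ∀ b, b ≠ a → k b = 0 := fun b hb => by have := hu b hb; omega
      set w : ℤ → ℂ := fun n => X ^ n * (((n : ℂ) - p a)⁻¹) ^ k a with hw
      have hprod : ∀ n : ℤ, ∏ l, (((n : ℂ) - p l)⁻¹) ^ k l = (((n : ℂ) - p a)⁻¹) ^ k a := by
        intro n
        rw [Finset.prod_eq_single a]
        · intro b _ hb; rw [hk0 b hb, pow_zero]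
        · simp
      have hT : ∑ l, X ^ p l * Tq E p k l = X ^ p a * E (k a) - ∑ l, w (p l) := by
        have : ∀ l, X ^ p l * Tq E p k l = (if l = a then X ^ p a * E (k a) else 0) - w (p l) := by
          intro l
          unfold Tq
          by_cases hl : l = a
          · subst hl
            have : Bq p k l = 1 := by
              unfold Bq
              refine Finset.prod_eq_one fun b hb => ?_
              rw [hk0 b (Finset.ne_of_mem_erase hb), pow_zero]
            rw [this, if_pos rfl]
            have e : ev E (k l) 1 = E (k l) := by
              unfold ev
              rw [Finset.sum_eq_single (k l)]
              · simp
              · intro i hi hne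
                simp only [Finset.mem_range] at hi
                rw [PowerSeries.coeff_one, if_neg (by omega), mul_zero]
              · simp
            rw [e]
            simp [hw, ha.ne']
          · rw [if_neg hl, hk0 l hl]
            have : Bq p k l = iv ((p l : ℂ) - p a) ^ k a := by
              unfold Bq
              rw [Finset.prod_eq_single a]
              · intro b _ hb; rw [hk0 b hb, pow_zero]
              · intro h; simp at h; exact absurd h.symm hl
            rw [this]
            simp [ev, hE0, hw, iv]
        simp only [this, Finset.sum_sub_distrib, Finset.sum_ite_eq', Finset.mem_univ, if_true]
      rw [hT]
      refine ((hE (k a) ha (p a)).sub_const (∑ l, w (p l))).congr' ?_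
      filter_upwards [eventually_ge_atTop (∑ l, (p l).natAbs)] with N hN
      have hsub : Finset.univ.image p ⊆ Finset.Icc (-(N : ℤ)) N := by
        intro n hn
        simp only [Finset.mem_image, Finset.mem_univ, true_and] at hn
        obtain ⟨l, rfl⟩ := hn
        have := Finset.single_le_sum (f := fun l => (p l).natAbs) (fun _ _ => Nat.zero_le _)
          (Finset.mem_univ l)
        simp only [Finset.mem_Icc]
        omega
      rw [← Finset.sum_image (f := w) (g := p) (s := Finset.univ) (fun x _ y _ h => hp h)]
      rw [sub_eq_iff_eq_add, ← Finset.sum_sdiff hsub]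
      congr 1
      rw [← Finset.sum_sdiff hsub (f := gq X p k)]
      rw [Finset.sum_eq_zero (s := Finset.univ.image p), add_zero]
      · refine Finset.sum_congr rfl fun n hn => ?_
        simp only [Finset.mem_sdiff, Finset.mem_image, Finset.mem_univ, true_and, not_exists] at hn
        rw [gq, if_neg (by rintro ⟨l, hl⟩; exact hn.2 l hl.symm), hprod]
      · intro n hn
        simp only [Finset.mem_image, Finset.mem_univ, true_and] at hn
        obtain ⟨l, rfl⟩ := hn
        rw [gq, if_pos ⟨l, rfl⟩]

end SymC
namespace SymC

def cns (m : ℤ) (c : ℕ → ℤ) : ℕ → ℤ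
  | 0 => m
  | l + 1 => c l

def glue (a : ℕ) (c1 : ℕ → ℤ) (p : ℤ) (c2 : ℕ → ℤ) : ℕ → ℤ := fun l =>
  if l < a then c1 l else if l = a then p else c2 (l - a - 1)

lemma cns_glue (a : ℕ) (m : ℤ) (c1 : ℕ → ℤ) (p : ℤ) (c2 : ℕ → ℤ) :
    cns m (glue a c1 p c2) = glue (a + 1) (cns m c1) p c2 := by
  funext l
  cases l with
  | zero => simp [cns, glue]
  | succ l => simp [cns, glue]

noncomputable def NS : ℕ → ℤ → ℤ → ((ℕ → ℤ) → ℂ) → ℂ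
  | 0, _, _, F => F (fun _ => 0)
  | n + 1, lo, hi, F => ∑ m ∈ Finset.Ioo lo hi, NS n m hi (fun c => F (cns m c))

def Chain (n : ℕ) (lo hi : ℤ) (c : ℕ → ℤ) : Prop :=
  (∀ l, l < n → lo < c l ∧ c l < hi) ∧ ∀ l l', l < l' → l' < n → c l < c l'

lemma Chain.cns {n : ℕ} {lo hi m : ℤ} {c : ℕ → ℤ} (h : Chain n m hi c) (h1 : lo < m) (h2 : m < hi) :
    Chain (n + 1) lo hi (cns m c) := by
  refine ⟨fun l hl => ?_, fun l l' hl hl' => ?_⟩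
  · cases l with
    | zero => exact ⟨h1, h2⟩
    | succ l => have := h.1 l (by omega); exact ⟨h1.trans this.1, this.2⟩
  · cases l' with
    | zero => omega
    | succ l' =>
      cases l with
      | zero => exact (h.1 l' (by omega)).1
      | succ l => exact h.2 l l' (by omega) (by omega)

lemma NS_congr (n : ℕ) (lo hi : ℤ) (F G : (ℕ → ℤ) → ℂ) (h : ∀ c, Chain n lo hi c → F c = G c) :
    NS n lo hi F = NS n lo hi G := by
  induction n generalizing lo F G with
  | zero => exact h _ ⟨by simp, by simp⟩
  | succ n ih =>
    refine Finset.sum_congr rfl fun m hm => ih _ _ _ fun c hc => h _ ?_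
    simp only [Finset.mem_Ioo] at hm
    exact hc.cns hm.1 hm.2

lemma NS_tendsto (n : ℕ) (lo hi : ℤ) (F : ℕ → (ℕ → ℤ) → ℂ) (G : (ℕ → ℤ) → ℂ)
    (h : ∀ c, Chain n lo hi c → Tendsto (fun N => F N c) atTop (nhds (G c))) :
    Tendsto (fun N => NS n lo hi (F N)) atTop (nhds (NS n lo hi G)) := by
  induction n generalizing lo F G with
  | zero => exact h _ ⟨by simp, by simp⟩
  | succ n ih =>
    refine tendsto_finsetSum _ fun m hm => ih _ (fun N c => F N (cns m c)) _ fun c hc => h _ ?_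
    simp only [Finset.mem_Ioo] at hm
    exact hc.cns hm.1 hm.2

lemma NS_sum {ι : Type*} (S : Finset ι) (n : ℕ) (lo hi : ℤ) (F : ι → (ℕ → ℤ) → ℂ) :
    NS n lo hi (fun c => ∑ i ∈ S, F i c) = ∑ i ∈ S, NS n lo hi (F i) := by
  induction n generalizing lo F with
  | zero => rfl
  | succ n ih =>
    simp only [NS]
    rw [Finset.sum_comm]
    exact Finset.sum_congr rfl fun m _ => ih m (fun i c => F i (cns m c))

lemma NS_mul (a : ℂ) (n : ℕ) (lo hi : ℤ) (F : (ℕ → ℤ) → ℂ) :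
    NS n lo hi (fun c => a * F c) = a * NS n lo hi F := by
  induction n generalizing lo F with
  | zero => rfl
  | succ n ih =>
    simp only [NS, Finset.mul_sum]
    exact Finset.sum_congr rfl fun m _ => ih m (fun c => F (cns m c))

lemma NS_mul_right (a : ℂ) (n : ℕ) (lo hi : ℤ) (F : (ℕ → ℤ) → ℂ) :
    NS n lo hi (fun c => F c * a) = NS n lo hi F * a := by
  simp only [mul_comm _ a]; exact NS_mul a n lo hi F

lemma NS_split (a b : ℕ) (lo hi : ℤ) (F : (ℕ → ℤ) → ℂ) :
    NS (a + b + 1) lo hi F = ∑ p ∈ Finset.Ioo lo hi,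
      NS a lo p (fun c1 => NS b p hi (fun c2 => F (glue a c1 p c2))) := by
  induction a generalizing lo F with
  | zero =>
    simp only [zero_add, NS]
    refine Finset.sum_congr rfl fun p _ => ?_
    congr 1; funext c2; congr 1; funext l
    cases l with
    | zero => simp [cns, glue]
    | succ l => simp [cns, glue]
  | succ a ih =>
    rw [show a + 1 + b + 1 = (a + b + 1) + 1 by ring]
    change ∑ m ∈ Finset.Ioo lo hi, NS (a + b + 1) m hi (fun c => F (cns m c)) = _
    rw [Finset.sum_congr rfl fun m _ => ih m (fun c => F (cns m c))]
    simp only [NS, cns_glue]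
    rw [Finset.sum_comm' (t' := Finset.Ioo lo hi) (s' := fun m => Finset.Ioo lo m)]
    intro x y; simp only [Finset.mem_Ioo]; omega

lemma NS_prod (n : ℕ) (lo hi : ℤ) (f : ℕ → ℤ → ℂ) :
    NS n lo hi (fun c => ∏ l ∈ Finset.range n, f l (c l)) = CL ((List.range n).map f) lo hi := by
  induction n generalizing lo f with
  | zero => simp [NS, CL]
  | succ n ih =>
    rw [List.range_succ_eq_map]
    simp only [NS, List.map_cons, CL, List.map_map]
    refine Finset.sum_congr rfl fun m _ => ?_
    have := ih m (fun l => f (l + 1))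
    rw [show (f ∘ Nat.succ) = fun l => f (l + 1) from rfl, ← this, ← NS_mul]
    congr 1; funext c
    rw [Finset.prod_range_succ', mul_comm]
    rfl

/-- inverted reversed list -/
noncomputable def il (L : List (ℕ × ℂ)) : List (ℕ × ℂ) := (L.map (fun q => (q.1, q.2⁻¹))).reverse

noncomputable def sg (L : List (ℕ × ℂ)) : ℂ := (-1) ^ (L.map Prod.fst).sum

lemma sg_append (L M : List (ℕ × ℂ)) : sg (L ++ M) = sg L * sg M := by
  simp [sg, pow_add]

lemma sg_cons (q : ℕ × ℂ) (M : List (ℕ × ℂ)) : sg (q :: M) = (-1) ^ q.1 * sg M := by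
  simp [sg, pow_add]

lemma CL_neg_aux (L : List (ℕ × ℂ)) (lo hi : ℤ) :
    CL ((L.map hh).map (fun f m => f (-m))) lo hi =
      sg L * CP (L.map (fun q => (q.1, q.2⁻¹))) lo hi := by
  induction L generalizing lo with
  | nil => simp [CL, CP, sg]
  | cons q L ih =>
    simp only [List.map_cons, CL, CP] at ih ⊢
    rw [sg_cons, Finset.mul_sum]
    refine Finset.sum_congr rfl fun m _ => ?_
    rw [ih, hh_neg]; ring

lemma sg_reverse (L : List (ℕ × ℂ)) : sg L.reverse = sg L := by
  simp [sg, List.sum_reverse]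

lemma CP_neg (L : List (ℕ × ℂ)) (lo hi : ℤ) : CP L (-hi) (-lo) = sg L * CP (il L) lo hi := by
  have h := CL_rev (L.map hh) (-hi) (-lo)
  rw [neg_neg, neg_neg, ← List.map_reverse, CL_neg_aux, sg_reverse, List.map_reverse] at h
  exact h.symm

lemma CP_append (H1 : List (ℕ × ℂ)) (q : ℕ × ℂ) (H2 : List (ℕ × ℂ)) (lo hi : ℤ) :
    CP (H1 ++ q :: H2) lo hi = ∑ m ∈ Finset.Ioo lo hi, CP H1 lo m * hh q m * CP H2 m hi := by
  simp only [CP, List.map_append, List.map_cons, CL_append]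

noncomputable def cv (K1 : List (ℕ × ℂ)) (q : ℕ × ℂ) (K2 : List (ℕ × ℂ)) (hi : ℤ) : ℂ :=
  ∑ p ∈ Finset.Ioo 0 hi, CP K1 0 p * hh q p * CP K2 0 (hi - p)

lemma cv_AS (K1 : List (ℕ × ℂ)) (q : ℕ × ℂ) (K2 : List (ℕ × ℂ)) (h1 : Adm (K1 ++ [q]))
    (h2 : Adm K2) :
    AS (fun N => cv K1 q K2 ((N : ℤ) + 1)) (cmzv (K1 ++ [q]) * cmzv K2) := by
  have hq : 0 < q.1 := (h1.1 q (by simp)).1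
  have key := AS_conv (fun p : ℕ => CP K1 0 (p : ℤ) * hh q (p : ℤ)) (fun n : ℕ => CP K2 0 ((n : ℤ) + 1))
    (cmzv (K1 ++ [q])) (cmzv K2) ?_ (CP_tendsto K2 h2)
  · convert key using 2 with N
    rw [Finset.Nat.sum_antidiagonal_eq_sum_range_succ_mk, Finset.sum_range_succ']
    simp only [Nat.cast_zero, hh_zero q hq, mul_zero, zero_mul, add_zero]
    unfold cv
    symm
    refine Finset.sum_bij (fun t _ => (((t + 1 : ℕ) : ℤ))) ?_ ?_ ?_ ?_
    · intro t ht; simp at ht ⊢; omega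
    · intro a _ b _ h; omega
    · intro b hb; simp only [Finset.mem_Ioo] at hb
      exact ⟨(b - 1).toNat, by simp; omega, by push_cast; omega⟩
    · intro t ht
      simp only [Finset.mem_range] at ht
      congr 2
      rw [Nat.cast_sub (by omega)]
      push_cast; ring
  · rw [← tendsto_add_atTop_iff_nat 1]
    refine (CP_tendsto (K1 ++ [q]) h1).congr fun N => ?_
    rw [CP_append, Finset.sum_range_succ']
    simp only [Nat.cast_zero, hh_zero q hq, mul_zero, add_zero]
    symm
    refine Finset.sum_bij (fun t _ => (((t + 1 : ℕ) : ℤ))) ?_ ?_ ?_ ?_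
    · intro t ht; simp at ht ⊢; omega
    · intro a _ b _ h; omega
    · intro b hb; simp only [Finset.mem_Ioo] at hb
      exact ⟨(b - 1).toNat, by simp; omega, by push_cast; omega⟩
    · intro t ht
      simp [CP, CL]

noncomputable def Sp (p : ℕ × ℂ) (K : List (ℕ × ℂ)) (hi : ℤ) : ℂ :=
  ∑' t : ℕ, hh p ((t : ℤ) + 1) * CP K ((t : ℤ) + 1) ((t : ℤ) + 1 + hi)

lemma Sp_AS (p : ℕ × ℂ) (K : List (ℕ × ℂ)) (hK : K ≠ []) (hA : Adm (p :: K)) :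
    AS (fun N => Sp p K ((N : ℤ) + 1)) (cmzv (p :: K)) :=
  AS_of_tendsto _ _ (Splus_tendsto p K hK hA)

lemma neg_mixed (q : ℕ × ℂ) (K1 K2 : List (ℕ × ℂ)) (hK2 : K2 ≠ []) (hi : ℤ) (M : ℕ) (hM : hi ≤ M) :
    ∑ n ∈ Finset.Icc (-(M : ℤ)) (-1), hh q n * (CP K1 n 0 * CP K2 0 (n + hi)) =
      (-1) ^ q.1 * sg K1 * cv (il K1) (q.1, q.2⁻¹) K2 hi := by
  have e1 : ∑ n ∈ Finset.Icc (-(M : ℤ)) (-1), hh q n * (CP K1 n 0 * CP K2 0 (n + hi)) =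
      ∑ p ∈ Finset.Icc 1 (M : ℤ), hh q (-p) * (CP K1 (-p) 0 * CP K2 0 (-p + hi)) := by
    refine Finset.sum_bij (fun m _ => -m) ?_ ?_ ?_ ?_
    · intro a; simp; omega
    · intro a _ b _; simp
    · intro b hb; refine ⟨-b, ?_, by ring⟩
      simp only [Finset.mem_Icc] at *; omega
    · intro m _; simp
  rw [e1, ← Finset.sum_subset (s₁ := Finset.Ioo 0 hi)]
  · unfold cv
    rw [Finset.mul_sum]
    refine Finset.sum_congr rfl fun p _ => ?_
    have := CP_neg K1 0 p
    rw [neg_zero] at this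
    rw [this, hh_neg, show -p + hi = hi - p by ring]
    ring
  · intro x; simp; omega
  · intro x h1 h2
    simp only [Finset.mem_Icc, Finset.mem_Ioo, not_and, not_lt] at h1 h2
    rw [CP, CP, CL_empty (K2.map hh) (by simpa using hK2)]
    · simp
    · have := h2 (by omega); omega

lemma neg_all (q0 q1 : ℕ × ℂ) (K : List (ℕ × ℂ)) (hi : ℤ) (M : ℕ) :
    ∑ n ∈ Finset.Icc (-(M : ℤ)) (-1), hh q0 n * CP (K ++ [q1]) n (min 0 (n + hi)) =
      sg (q0 :: (K ++ [q1])) * ∑ t ∈ Finset.range M, hh (q1.1, q1.2⁻¹) ((t : ℤ) + 1) *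
        CP (il K ++ [(q0.1, q0.2⁻¹)]) ((t : ℤ) + 1) (min ((t : ℤ) + 1 + hi) (M + 1)) := by
  have e1 : ∑ n ∈ Finset.Icc (-(M : ℤ)) (-1), hh q0 n * CP (K ++ [q1]) n (min 0 (n + hi)) =
      ∑ e ∈ Finset.Icc 1 (M : ℤ), ∑ f ∈ (Finset.Icc 1 (M : ℤ)).filter (fun f => f < e ∧ e < f + hi),
        sg (q0 :: (K ++ [q1])) * (hh (q1.1, q1.2⁻¹) f * (CP (il K) f e * hh (q0.1, q0.2⁻¹) e)) := by
    refine Finset.sum_bij (fun m _ => -m) ?_ ?_ ?_ ?_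
    · intro a; simp; omega
    · intro a _ b _; simp
    · intro b hb; refine ⟨-b, ?_, by ring⟩
      simp only [Finset.mem_Icc] at *; omega
    · intro n hn
      simp only [Finset.mem_Icc] at hn
      rw [CP_append, Finset.mul_sum]
      refine Finset.sum_bij (fun m _ => -m) ?_ ?_ ?_ ?_
      · intro a; simp; omega
      · intro a _ b _; simp
      · intro b hb; refine ⟨-b, ?_, by ring⟩
        simp only [Finset.mem_Icc, Finset.mem_filter, Finset.mem_Ioo, lt_min_iff] at *; omega
      · intro b hb
        have h1 := CP_neg K (-b) (-n)
        have h2 := hh_neg q0 (-n)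
        have h3 := hh_neg q1 (-b)
        rw [neg_neg] at h2 h3
        rw [neg_neg, neg_neg] at h1
        rw [h1, h2, h3, sg_cons, sg_append]
        simp [CP, CL, sg]
        ring
  have e2 : ∑ t ∈ Finset.range M, hh (q1.1, q1.2⁻¹) ((t : ℤ) + 1) *
        CP (il K ++ [(q0.1, q0.2⁻¹)]) ((t : ℤ) + 1) (min ((t : ℤ) + 1 + hi) (M + 1)) =
      ∑ f ∈ Finset.Icc 1 (M : ℤ), hh (q1.1, q1.2⁻¹) f *
        CP (il K ++ [(q0.1, q0.2⁻¹)]) f (min (f + hi) (M + 1)) := by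
    refine Finset.sum_bij (fun t _ => (t : ℤ) + 1) ?_ ?_ ?_ ?_
    · intro t ht; simp at ht ⊢; omega
    · intro a _ b _ h; omega
    · intro b hb; simp only [Finset.mem_Icc] at hb
      exact ⟨(b - 1).toNat, by simp; omega, by omega⟩
    · intro t _; rfl
  rw [e1, e2, Finset.mul_sum]
  rw [Finset.sum_comm' (t' := Finset.Icc 1 (M : ℤ))
    (s' := fun f => Finset.Ioo f (min (f + hi) (M + 1)))]
  · refine Finset.sum_congr rfl fun f _ => ?_
    rw [CP_append, Finset.mul_sum, Finset.mul_sum]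
    refine Finset.sum_congr rfl fun e _ => ?_
    simp [CP, CL]
  · intro x y
    simp only [Finset.mem_Icc, Finset.mem_filter, Finset.mem_Ioo, lt_min_iff]; omega

lemma il_cons_append (q0 q1 : ℕ × ℂ) (K : List (ℕ × ℂ)) :
    il (q0 :: (K ++ [q1])) = (q1.1, q1.2⁻¹) :: (il K ++ [(q0.1, q0.2⁻¹)]) := by
  simp [il]

lemma Lside (q0 q1 : ℕ × ℂ) (K' : List (ℕ × ℂ)) (hA : Adm (q0 :: (K' ++ [q1])))
    (hB : Adm (il (q0 :: (K' ++ [q1])))) (hi : ℤ) :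
    Tendsto (fun M : ℕ => ∑ n ∈ Finset.Icc (-(M : ℤ)) M, hh q0 n * CP (K' ++ [q1]) n (n + hi)) atTop
      (nhds (Sp q0 (K' ++ [q1]) hi
        + (∑ j ∈ Finset.range (K' ++ [q1]).length, (-1) ^ q0.1 * sg ((K' ++ [q1]).take j) *
          cv (il ((K' ++ [q1]).take j)) (q0.1, q0.2⁻¹) ((K' ++ [q1]).drop j) hi)
        + sg (q0 :: (K' ++ [q1])) * Sp (q1.1, q1.2⁻¹) (il K' ++ [(q0.1, q0.2⁻¹)]) hi)) := by
  have hq0 : 0 < q0.1 := (hA.1 q0 (by simp)).1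
  have t1 := Splus_trunc q0 (K' ++ [q1]) (by simp) hA hi (fun _ n => (n : ℤ) + 1 + hi)
    (fun n => Eventually.of_forall fun _ => rfl)
  rw [il_cons_append] at hB
  have t2 := Splus_trunc (q1.1, q1.2⁻¹) (il K' ++ [(q0.1, q0.2⁻¹)]) (by simp) hB hi
    (fun M n => min ((n : ℤ) + 1 + hi) (M + 1)) (fun n => by
      filter_upwards [eventually_ge_atTop (n + hi.natAbs)] with M hM
      apply min_eq_left; omega)
  have t3 := (t1.add_const (∑ j ∈ Finset.range (K' ++ [q1]).length, (-1) ^ q0.1 *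
    sg ((K' ++ [q1]).take j) *
          cv (il ((K' ++ [q1]).take j)) (q0.1, q0.2⁻¹) ((K' ++ [q1]).drop j) hi)).add
    (t2.const_mul (sg (q0 :: (K' ++ [q1]))))
  refine t3.congr' ?_
  filter_upwards [eventually_ge_atTop hi.natAbs] with M hM
  have e0 : Finset.Icc (-(M : ℤ)) M = (Finset.Icc 1 (M : ℤ) ∪ Finset.Icc (-(M : ℤ)) (-1)) ∪ {0} := by
    ext x; simp; omega
  rw [e0, Finset.sum_union, Finset.sum_union, Finset.sum_singleton, hh_zero q0 hq0, zero_mul, add_zero,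
    add_assoc]
  · congr 1
    · refine Finset.sum_bij (fun t _ => (t : ℤ) + 1) ?_ ?_ ?_ ?_
      · intro t ht; simp at ht ⊢; omega
      · intro a _ b _ h; omega
      · intro b hb; simp only [Finset.mem_Icc] at hb
        exact ⟨(b - 1).toNat, by simp; omega, by omega⟩
      · intro t _; rfl
    · rw [← neg_all, add_comm]
      have : ∀ n ∈ Finset.Icc (-(M : ℤ)) (-1), hh q0 n * CP (K' ++ [q1]) n (n + hi) =
          hh q0 n * CP (K' ++ [q1]) n (min 0 (n + hi)) +
          ∑ j ∈ Finset.range (K' ++ [q1]).length, hh q0 n *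
            (CP ((K' ++ [q1]).take j) n 0 * CP ((K' ++ [q1]).drop j) 0 (n + hi)) := by
        intro n hn
        simp only [Finset.mem_Icc] at hn
        rw [← Finset.mul_sum, ← mul_add]
        congr 1
        have := CL_sign' ((K' ++ [q1]).map hh) (by
          intro f hf
          obtain ⟨q, hq, rfl⟩ := List.mem_map.1 hf
          exact hh_zero q (hA.1 q (List.mem_cons_of_mem _ hq)).1) n (n + hi) (by omega)
        simp only [List.length_map, ← List.map_take, ← List.map_drop] at this
        exact this
      rw [Finset.sum_congr rfl this, Finset.sum_add_distrib, Finset.sum_comm]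
      congr 1
      refine Finset.sum_congr rfl fun j hj => ?_
      rw [neg_mixed _ _ _ _ _ _ (by omega)]
      simp only [Finset.mem_range] at hj
      intro h; rw [List.drop_eq_nil_iff] at h; omega
  · rw [Finset.disjoint_left]; intro x; simp; omega
  · rw [Finset.disjoint_left]; intro x; simp; omega

end SymC
namespace SymC

lemma iv_eq (e : ℂ) (he : e ≠ 0) : iv e = PowerSeries.C e⁻¹ *
    PowerSeries.rescale (-e⁻¹) (PowerSeries.mk (1 : ℕ → ℂ)) := by
  have h : (PowerSeries.C e + PowerSeries.X) * (PowerSeries.C e⁻¹ *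
      PowerSeries.rescale (-e⁻¹) (PowerSeries.mk (1 : ℕ → ℂ))) = 1 := by
    ext n
    cases n with
    | zero =>
      rw [add_mul, map_add, PowerSeries.coeff_C_mul, PowerSeries.coeff_zero_X_mul,
        PowerSeries.coeff_C_mul, PowerSeries.coeff_rescale]
      simp [he]
    | succ n =>
      rw [add_mul, map_add, PowerSeries.coeff_C_mul, PowerSeries.coeff_succ_X_mul]
      simp only [PowerSeries.coeff_C_mul, PowerSeries.coeff_rescale, PowerSeries.coeff_mk,
        PowerSeries.coeff_one, Pi.one_apply]
      simp only [Nat.add_eq_zero_iff, one_ne_zero, and_false, if_false]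
      rw [← mul_assoc, mul_inv_cancel₀ he, pow_succ]
      ring
  calc iv e = iv e * 1 := by rw [mul_one]
    _ = ((PowerSeries.C e + PowerSeries.X) * iv e) * (PowerSeries.C e⁻¹ *
      PowerSeries.rescale (-e⁻¹) (PowerSeries.mk (1 : ℕ → ℂ))) := by
        rw [← h]; ring
    _ = _ := by rw [iv_mul e he, one_mul]

/-- signed binomial coefficient -/
noncomputable def cf (k m : ℕ) : ℂ := (-1) ^ m * (Nat.choose (m + k - 1) (k - 1) : ℂ)

noncomputable def Gs (q : ℕ × ℂ) (e : ℤ) : PowerSeries ℂ :=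
  PowerSeries.C (q.2 ^ e) * iv (e : ℂ) ^ q.1

lemma coeff_Gs (k : ℕ) (x : ℂ) (hk : 0 < k) (e : ℤ) (he : e ≠ 0) (m : ℕ) :
    PowerSeries.coeff m (Gs (k, x) e) = cf k m * hh (k + m, x) e := by
  obtain ⟨k, rfl⟩ : ∃ k', k = k' + 1 := ⟨k - 1, by omega⟩
  have he' : (e : ℂ) ≠ 0 := by exact_mod_cast he
  unfold Gs
  rw [iv_eq _ he', mul_pow, ← map_pow, ← map_pow, PowerSeries.mk_one_pow_eq_mk_choose_add,
    PowerSeries.coeff_C_mul, PowerSeries.coeff_C_mul, PowerSeries.coeff_rescale,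
    PowerSeries.coeff_mk]
  simp only [cf, hh]
  rw [show m + (k + 1) - 1 = k + m by omega, show k + 1 - 1 = k by omega, neg_pow,
    pow_add (e : ℂ) (k + 1) m, div_eq_mul_inv, mul_inv, inv_pow, inv_pow]
  ring

lemma coeff_tuple (r M : ℕ) (G : Fin r → PowerSeries ℂ) :
    PowerSeries.coeff M (∏ l, G l) = ∑ m ∈ Finset.Nat.antidiagonalTuple r M,
      ∏ l, PowerSeries.coeff (m l) (G l) := by
  rw [PowerSeries.coeff_prod]
  refine Finset.sum_bij' (fun l _ => ⇑l) (fun m _ => Finsupp.equivFunOnFinite.symm m) ?_ ?_ ?_ ?_ ?_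
  · intro a ha
    rw [Finset.Nat.mem_antidiagonalTuple]
    simpa using ha
  · intro a ha
    rw [Finset.Nat.mem_antidiagonalTuple] at ha
    simpa using ha
  · intro a ha; ext i; simp
  · intro a ha; ext i; simp
  · intro a ha; rfl

lemma coeff_tuple_erase (r M : ℕ) (J : Fin r) (G : Fin r → PowerSeries ℂ) :
    PowerSeries.coeff M (∏ l ∈ Finset.univ.erase J, G l) =
      ∑ m ∈ (Finset.Nat.antidiagonalTuple r M).filter (fun m => m J = 0),
      ∏ l ∈ Finset.univ.erase J, PowerSeries.coeff (m l) (G l) := by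
  have h : ∏ l ∈ Finset.univ.erase J, G l = ∏ l, Function.update G J 1 l := by
    rw [← Finset.mul_prod_erase _ _ (Finset.mem_univ J), Function.update_self, one_mul]
    exact Finset.prod_congr rfl fun l hl => by
      rw [Function.update_of_ne (Finset.ne_of_mem_erase hl)]
  rw [h, coeff_tuple, Finset.sum_filter]
  refine Finset.sum_congr rfl fun m _ => ?_
  rw [← Finset.mul_prod_erase _ _ (Finset.mem_univ J), Function.update_self,
    PowerSeries.coeff_one]
  split_ifs
  · rw [one_mul]
    exact Finset.prod_congr rfl fun l hl => by
      rw [Function.update_of_ne (Finset.ne_of_mem_erase hl)]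
  · rw [zero_mul]

lemma prod_erase_zero {M : Type*} [CommMonoid M] (r : ℕ) (f : Fin (r + 1) → M) :
    ∏ l ∈ Finset.univ.erase 0, f l = ∏ l : Fin r, f l.succ := by
  have : Finset.univ.erase (0 : Fin (r + 1)) = Finset.univ.image Fin.succ := by
    ext l; simp
  rw [this, Finset.prod_image fun a _ b _ h => Fin.succ_injective r h]

lemma prod_erase_succ {M : Type*} [CommMonoid M] (r : ℕ) (J : Fin r) (f : Fin (r + 1) → M) :
    ∏ l ∈ Finset.univ.erase J.succ, f l = (∏ l ∈ Finset.univ.erase J, f l.succ) * f 0 := by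
  have : Finset.univ.erase J.succ = insert 0 ((Finset.univ.erase J).image Fin.succ) := by
    ext l
    refine Fin.cases ?_ (fun l => ?_) l
    · simp [Fin.succ_ne_zero, eq_comm]
    · simp
  rw [this, Finset.prod_insert (by simp [Fin.succ_ne_zero]),
    Finset.prod_image fun a _ b _ h => Fin.succ_injective r h, mul_comm]

noncomputable def P0 (r : ℕ) (k : ℕ → ℕ) (x : ℕ → ℂ) (E : ℕ → ℂ) (c : ℕ → ℤ) : ℂ :=
  ∑ i ∈ Finset.range (k 0 + 1), ∑ m ∈ Finset.Nat.antidiagonalTuple r (k 0 - i),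
    E i * ∏ l : Fin r, (cf (k (l.val + 1)) (m l) *
      hh (k (l.val + 1) + m l, x (l.val + 1)) (c l))

noncomputable def PJ (r : ℕ) (k : ℕ → ℕ) (x : ℕ → ℂ) (E : ℕ → ℂ) (J : Fin r) (c : ℕ → ℤ) : ℂ :=
  ∑ i ∈ Finset.range (k (J.val + 1) + 1), ∑ m ∈ Finset.range (k (J.val + 1) + 1 - i),
    ∑ mm ∈ (Finset.Nat.antidiagonalTuple r m).filter (fun mm => mm J = 0),
      E i * ((∏ l ∈ Finset.univ.erase J, (cf (k (l.val + 1)) (mm l) *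
        hh (k (l.val + 1) + mm l, x (l.val + 1)) (c l - c J))) *
        (cf (k 0) (k (J.val + 1) - i - m) *
          hh (k 0 + (k (J.val + 1) - i - m), x 0) (-c J)))

lemma chain_lim (r : ℕ) (k : ℕ → ℕ) (x : ℕ → ℂ) (X : ℂ) (E : ℕ → ℂ)
    (hk : ∀ i, i ≤ r → 0 < k i) (hx : ∀ i, i ≤ r → x i ≠ 0)
    (hX : X = ∏ i ∈ Finset.range (r + 1), x i) (hE0 : E 0 = -1)
    (hE : ∀ t, 1 ≤ t → ∀ q : ℤ, Tendsto (fun N : ℕ => ∑ n ∈ Finset.Icc (-(N : ℤ)) N,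
      X ^ n * (((n : ℂ) - q)⁻¹) ^ t) atTop (nhds (X ^ q * E t)))
    (hi : ℤ) (c : ℕ → ℤ) (hc : Chain r 0 hi c) :
    Tendsto (fun N : ℕ => ∑ n ∈ Finset.Icc (-(N : ℤ)) N,
      hh (k 0, x 0) n * ∏ l ∈ Finset.range r, hh (k (l + 1), x (l + 1)) (n + c l)) atTop
      (nhds (P0 r k x E c + ∑ J : Fin r, PJ r k x E J c)) := by
  have hd : ∀ l l' : ℕ, l < l' → l' < r + 1 → cns 0 c l < cns 0 c l' := by
    have : Chain (r + 1) (-1) hi (cns 0 c) ∨ True := Or.inr trivial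
    intro l l' h h'
    cases l' with
    | zero => omega
    | succ l' =>
      cases l with
      | zero => exact (hc.1 l' (by omega)).1
      | succ l => exact hc.2 l l' (by omega) (by omega)
  set d : Fin (r + 1) → ℤ := fun l => cns 0 c l with hdd
  have hdi : Function.Injective d := by
    intro a b hab
    by_contra hne
    rcases lt_or_gt_of_ne hne with h | h
    · exact absurd hab (hd a b h b.2).ne
    · exact absurd hab (hd b a h a.2).ne'
  set kk : Fin (r + 1) → ℕ := fun l => k l with hkk
  set xx : Fin (r + 1) → ℂ := fun l => x l with hxx
  have hx' : ∀ l, xx l ≠ 0 := fun l => hx l (by omega)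
  have hX' : X = ∏ l, xx l := by rw [hX, Finset.prod_range]
  have hXn : ∀ n : ℤ, X ^ n = ∏ l, xx l ^ n := by
    intro n; rw [hX', Finset.prod_zpow]
  have key := (PF X E hE0 hE (fun l => - d l) (fun a b h => hdi (neg_injective h)) _ kk rfl 0
    (hk 0 (by omega))).const_mul (∏ l, xx l ^ d l)
  have e1 : ∀ n : ℤ, hh (k 0, x 0) n * ∏ l ∈ Finset.range r, hh (k (l + 1), x (l + 1)) (n + c l)
      = (∏ l, xx l ^ d l) * gq X (fun l => - d l) kk n := by
    intro n
    have : hh (k 0, x 0) n * ∏ l ∈ Finset.range r, hh (k (l + 1), x (l + 1)) (n + c l)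
        = ∏ l, hh (kk l, xx l) (n + d l) := by
      rw [Fin.prod_univ_succ, Finset.prod_range]
      simp [hdd, hkk, hxx, cns]
    rw [this]
    unfold gq
    split_ifs with h
    · obtain ⟨l, hl⟩ := h
      rw [mul_zero]
      refine Finset.prod_eq_zero (Finset.mem_univ l) ?_
      have hp : kk l ≠ 0 := (hk l (by omega)).ne'
      simp [hh, hl, hp]
    · rw [hXn, ← mul_assoc, ← Finset.prod_mul_distrib, ← Finset.prod_mul_distrib]
      refine Finset.prod_congr rfl fun l _ => ?_
      simp only [hh]
      rw [zpow_add₀ (hx' l), inv_pow, div_eq_mul_inv]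
      push_cast
      rw [sub_neg_eq_add]
      ring
  simp only [Finset.mul_sum, ← e1] at key
  have e2 : ∀ j : Fin (r + 1), (∏ l, xx l ^ d l) * (X ^ (- d j) * Tq E (fun l => - d l) kk j)
      = ∑ i ∈ Finset.range (kk j + 1), E i * PowerSeries.coeff (kk j - i)
          (∏ l ∈ Finset.univ.erase j, Gs (kk l, xx l) (d l - d j)) := by
    intro j
    unfold Tq ev
    rw [Finset.mul_sum, Finset.mul_sum]
    refine Finset.sum_congr rfl fun i _ => ?_
    have : ∏ l ∈ Finset.univ.erase j, Gs (kk l, xx l) (d l - d j) =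
        PowerSeries.C (∏ l ∈ Finset.univ.erase j, xx l ^ (d l - d j)) *
          Bq (fun l => - d l) kk j := by
      unfold Bq Gs
      rw [map_prod, ← Finset.prod_mul_distrib]
      refine Finset.prod_congr rfl fun l _ => ?_
      congr 3
      push_cast; ring
    rw [this, PowerSeries.coeff_C_mul]
    have h2 : (∏ l, xx l ^ d l) * X ^ (- d j) = ∏ l ∈ Finset.univ.erase j, xx l ^ (d l - d j) := by
      rw [hXn, ← Finset.prod_mul_distrib, ← Finset.mul_prod_erase _ _ (Finset.mem_univ j)]
      rw [← zpow_add₀ (hx' j), add_neg_cancel, zpow_zero, one_mul]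
      exact Finset.prod_congr rfl fun l _ => by rw [← zpow_add₀ (hx' l), sub_eq_add_neg]
    rw [← h2]; ring
  simp only [e2] at key
  rw [Fin.sum_univ_succ] at key
  convert key using 2
  congr 1
  · unfold P0
    refine Finset.sum_congr rfl fun i _ => ?_
    rw [prod_erase_zero, coeff_tuple, Finset.mul_sum]
    refine Finset.sum_congr rfl fun m _ => ?_
    congr 1
    refine Finset.prod_congr rfl fun l _ => ?_
    have h1 : d l.succ - d 0 = c l := by simp [hdd, cns]
    rw [h1, coeff_Gs _ _ (hk _ (by have := l.succ.2; omega)) _ (hc.1 l l.2).1.ne']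
    rfl
  · refine Finset.sum_congr rfl fun J _ => ?_
    unfold PJ
    refine Finset.sum_congr rfl fun i hi' => ?_
    have hi2 : i ≤ k (J.val + 1) := by
      have : i < k (J.val + 1) + 1 := Finset.mem_range.1 hi'
      omega
    rw [prod_erase_succ, PowerSeries.coeff_mul,
      Finset.Nat.sum_antidiagonal_eq_sum_range_succ (fun a b => PowerSeries.coeff a _ *
        PowerSeries.coeff b _), Finset.mul_sum]
    have e3 : kk J.succ = k (J.val + 1) := rfl
    rw [e3, show (k (J.val + 1) - i).succ = k (J.val + 1) + 1 - i by omega]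
    refine Finset.sum_congr rfl fun m _ => ?_
    rw [coeff_tuple_erase, Finset.sum_mul, Finset.mul_sum]
    refine Finset.sum_congr rfl fun mm _ => ?_
    congr 2
    · refine Finset.prod_congr rfl fun l hl => ?_
      have h1 : d l.succ - d J.succ = c l - c J := by simp [hdd, cns]
      rw [h1, coeff_Gs _ _ (hk _ (by have := l.succ.2; omega))]
      · rfl
      · rw [← h1, sub_ne_zero]
        intro h
        exact Finset.ne_of_mem_erase hl (Fin.succ_injective _ (hdi h))
    · have h1 : d 0 - d J.succ = - c J := by simp [hdd, cns]
      rw [h1, coeff_Gs _ _ (hk _ (by omega)) _ (by have := (hc.1 J J.2).1; omega)]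
      rfl

end SymC
namespace SymC

lemma NS_ofFn (n : ℕ) (lo hi : ℤ) (f : Fin n → ℤ → ℂ) :
    NS n lo hi (fun c => ∏ l : Fin n, f l (c l)) = CL (List.ofFn f) lo hi := by
  induction n generalizing lo with
  | zero => simp [NS, CL]
  | succ n ih =>
    rw [List.ofFn_succ]
    simp only [NS, CL]
    refine Finset.sum_congr rfl fun m _ => ?_
    rw [← ih m (fun l => f l.succ), ← NS_mul]
    congr 1; funext c
    rw [Fin.prod_univ_succ]
    rfl

lemma NS_P0 (r : ℕ) (k : ℕ → ℕ) (x : ℕ → ℂ) (E : ℕ → ℂ) (hi : ℤ) :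
    NS r 0 hi (P0 r k x E) = ∑ i ∈ Finset.range (k 0 + 1),
      ∑ m ∈ Finset.Nat.antidiagonalTuple r (k 0 - i),
      (E i * ∏ l : Fin r, cf (k (l.val + 1)) (m l)) *
        CP (List.ofFn fun l : Fin r => (k (l.val + 1) + m l, x (l.val + 1))) 0 hi := by
  unfold P0
  rw [NS_sum]
  refine Finset.sum_congr rfl fun i _ => ?_
  rw [NS_sum]
  refine Finset.sum_congr rfl fun m _ => ?_
  simp only [Finset.prod_mul_distrib, ← mul_assoc]
  rw [NS_mul, CP, List.map_ofFn]
  congr 1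
  exact NS_ofFn r 0 hi (fun l => hh (k (l.val + 1) + m l, x (l.val + 1)))

lemma prod_erase_range {M : Type*} [CommMonoid M] (a b : ℕ) (f : ℕ → M) :
    ∏ l ∈ (Finset.range (a + b + 1)).erase a, f l =
      (∏ l ∈ Finset.range a, f l) * ∏ l ∈ Finset.range b, f (a + 1 + l) := by
  have : (Finset.range (a + b + 1)).erase a = (Finset.range a) ∪
      (Finset.range b).image (fun l => a + 1 + l) := by
    ext l
    simp only [Finset.mem_erase, Finset.mem_range, Finset.mem_union, Finset.mem_image]
    constructor
    · intro h
      by_cases hl : l < a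
      · exact Or.inl hl
      · exact Or.inr ⟨l - a - 1, by omega, by omega⟩
    · rintro (h | ⟨t, h, rfl⟩) <;> omega
  rw [this, Finset.prod_union, Finset.prod_image]
  · intro p _ q _ h; simpa using h
  · rw [Finset.disjoint_left]
    intro l hl hl'
    simp only [Finset.mem_range, Finset.mem_image] at hl hl'
    obtain ⟨t, _, rfl⟩ := hl'
    omega

lemma NS_shift (n : ℕ) (lo hi p : ℤ) (Q : ℕ → ℕ × ℂ) :
    NS n lo hi (fun c => ∏ l ∈ Finset.range n, hh (Q l) (c l - p)) =
      CP ((List.range n).map Q) (lo - p) (hi - p) := by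
  rw [NS_prod n lo hi (fun l m => hh (Q l) (m - p)), CP, ← CL_shift (((List.range n).map Q).map hh) p (lo - p) (hi - p)]
  simp only [List.map_map, sub_add_cancel]
  rfl

lemma poleN (a b : ℕ) (Q : ℕ → ℕ × ℂ) (q0 : ℕ × ℂ) (hi : ℤ) :
    NS (a + b + 1) 0 hi (fun c => (∏ l ∈ (Finset.range (a + b + 1)).erase a,
      hh (Q l) (c l - c a)) * hh q0 (-c a)) =
      (sg ((List.range a).map Q) * (-1) ^ q0.1) *
        cv (il ((List.range a).map Q)) (q0.1, q0.2⁻¹)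
          ((List.range b).map (fun t => Q (a + 1 + t))) hi := by
  rw [NS_split]
  unfold cv
  rw [Finset.mul_sum]
  refine Finset.sum_congr rfl fun p _ => ?_
  have e1 : ∀ c1 c2 : ℕ → ℤ, (∏ l ∈ (Finset.range (a + b + 1)).erase a,
      hh (Q l) (glue a c1 p c2 l - glue a c1 p c2 a)) * hh q0 (-glue a c1 p c2 a) =
      (∏ l ∈ Finset.range a, hh (Q l) (c1 l - p)) * hh q0 (-p) *
       ∏ l ∈ Finset.range b, hh (Q (a + 1 + l)) (c2 l - p) := by
    intro c1 c2
    have ga : glue a c1 p c2 a = p := by simp [glue]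
    rw [ga, prod_erase_range]
    have h1 : ∏ l ∈ Finset.range a, hh (Q l) (glue a c1 p c2 l - p) =
        ∏ l ∈ Finset.range a, hh (Q l) (c1 l - p) :=
      Finset.prod_congr rfl fun l hl => by
        have := Finset.mem_range.1 hl
        simp [glue, this]
    have h2 : ∏ l ∈ Finset.range b, hh (Q (a + 1 + l)) (glue a c1 p c2 (a + 1 + l) - p) =
        ∏ l ∈ Finset.range b, hh (Q (a + 1 + l)) (c2 l - p) :=
      Finset.prod_congr rfl fun l _ => by
        have g : glue a c1 p c2 (a + 1 + l) = c2 l := by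
          unfold glue
          rw [if_neg (by omega), if_neg (by omega)]
          congr 1; omega
        rw [g]
    rw [h1, h2]; ring
  simp only [e1, NS_mul, NS_mul_right]
  rw [NS_shift, NS_shift b p hi p (fun t => Q (a + 1 + t)), sub_self, zero_sub]
  have := CP_neg ((List.range a).map Q) 0 p
  rw [neg_zero] at this
  rw [this, hh_neg]
  ring

lemma Adm_ofFn (n : ℕ) (f : Fin n → ℕ × ℂ) (h1 : ∀ i, 0 < (f i).1 ∧ ‖(f i).2‖ = 1)
    (h2 : ∀ i, i.val + 1 = n → ¬((f i).1 = 1 ∧ (f i).2 = 1)) : Adm (List.ofFn f) := by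
  refine ⟨fun p hp => ?_, fun p hp => ?_⟩
  · rw [List.mem_ofFn] at hp
    obtain ⟨i, rfl⟩ := hp
    exact h1 i
  · cases n with
    | zero => simp at hp
    | succ n =>
      rw [List.getLast?_eq_getElem?] at hp
      rw [Option.mem_def, List.length_ofFn, Nat.add_sub_cancel, List.getElem?_ofFn,
        dif_pos (Nat.lt_succ_self n), Option.some.injEq] at hp
      rw [← hp]
      exact h2 _ rfl

lemma Adm_snoc (L : List (ℕ × ℂ)) (q : ℕ × ℂ) (h1 : ∀ p ∈ L, 0 < p.1 ∧ ‖p.2‖ = 1)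
    (h2 : 0 < q.1 ∧ ‖q.2‖ = 1) (h3 : ¬(q.1 = 1 ∧ q.2 = 1)) : Adm (L ++ [q]) := by
  refine ⟨fun p hp => ?_, fun p hp => ?_⟩
  · rcases List.mem_append.1 hp with h | h
    · exact h1 p h
    · rw [List.mem_singleton] at h; rw [h]; exact h2
  · simp at hp; rw [← hp]; exact h3

lemma AS_P0 (r : ℕ) (k : ℕ → ℕ) (x : ℕ → ℂ) (E : ℕ → ℂ)
    (hk : ∀ i, i ≤ r → 0 < k i) (hx : ∀ i, i ≤ r → ‖x i‖ = 1)
    (hr : ¬(k r = 1 ∧ x r = 1)) :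
    AS (fun N : ℕ => NS r 0 ((N : ℤ) + 1) (P0 r k x E))
      (∑ j ∈ Finset.range (k 0 + 1), ∑ m ∈ Finset.Nat.antidiagonalTuple r (k 0 - j),
        ((-1 : ℂ) ^ (k 0 - j)
            * ∏ l : Fin r, (Nat.choose (m l + k (l.val + 1) - 1) (k (l.val + 1) - 1) : ℂ))
          * E j
          * cmzv (List.ofFn fun l : Fin r => (k (l.val + 1) + m l, x (l.val + 1)))) := by
  simp only [NS_P0]
  refine AS.sum _ _ _ fun j _ => AS.sum _ _ _ fun m hm => ?_
  rw [Finset.Nat.mem_antidiagonalTuple] at hm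
  have : (E j * ∏ l : Fin r, cf (k (l.val + 1)) (m l)) = ((-1 : ℂ) ^ (k 0 - j)
            * ∏ l : Fin r, (Nat.choose (m l + k (l.val + 1) - 1) (k (l.val + 1) - 1) : ℂ))
          * E j := by
    simp only [cf, Finset.prod_mul_distrib]
    rw [Finset.prod_pow_eq_pow_sum, hm]; ring
  rw [this]
  refine AS.const_mul _ ?_
  refine AS_of_tendsto _ _ (CP_tendsto _ ?_)
  refine Adm_ofFn _ _ (fun i => ⟨?_, hx _ (by omega)⟩) (fun i hi => ?_)
  · have := hk (i.val + 1) (by omega)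
    simp only; omega
  · simp only [hi]
    rintro ⟨h1, h2⟩
    have := hk r le_rfl
    exact hr ⟨by omega, h2⟩

end SymC
namespace SymC

lemma prod_fin_erase {M : Type*} [CommMonoid M] (r : ℕ) (J : Fin r) (f : ℕ → M) :
    ∏ l ∈ Finset.univ.erase J, f l.val = ∏ l ∈ (Finset.range r).erase J.val, f l := by
  refine Finset.prod_bij (fun l _ => l.val) ?_ ?_ ?_ ?_
  · intro l hl
    have := Finset.ne_of_mem_erase hl
    simp only [Finset.mem_erase, Finset.mem_range, l.2, and_true]
    exact fun h => this (Fin.ext h)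
  · intro a _ b _ h; exact Fin.ext h
  · intro b hb
    simp only [Finset.mem_erase, Finset.mem_range] at hb
    refine ⟨⟨b, hb.2⟩, ?_, rfl⟩
    simp only [Finset.mem_erase, Finset.mem_univ, and_true]
    intro h; exact hb.1 (congrArg Fin.val h)
  · intros; rfl

lemma sum_fin_gt (a b : ℕ) (J : Fin (a + b + 1)) (hJ : J.val = a) (f : ℕ → ℕ) :
    ∑ l ∈ Finset.univ.filter (fun l => J < l), f l.val = ∑ t ∈ Finset.range b, f (a + 1 + t) := by
  symm
  refine Finset.sum_bij (fun t ht => (⟨a + 1 + t, by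
    have := Finset.mem_range.1 ht; omega⟩ : Fin (a + b + 1))) ?_ ?_ ?_ ?_
  · intro t ht
    simp only [Finset.mem_filter, Finset.mem_univ, true_and, Fin.lt_def]
    omega
  · intro s _ t _ h
    have := congrArg Fin.val h
    simp only at this; omega
  · intro l hl
    simp only [Finset.mem_filter, Finset.mem_univ, true_and, Fin.lt_def] at hl
    have := l.2
    exact ⟨l.val - (a + 1), Finset.mem_range.2 (by omega), Fin.ext (by simp only; omega)⟩
  · intros; rfl

lemma list_sum_range (n : ℕ) (f : ℕ → ℕ) : ((List.range n).map f).sum = ∑ t ∈ Finset.range n, f t := by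
  induction n with
  | zero => simp
  | succ n ih => rw [List.range_succ, Finset.sum_range_succ, List.map_append, List.sum_append, ih]; simp

/-- one summand of the pole sum -/
lemma AS_PJterm (a b : ℕ) (k : ℕ → ℕ) (x : ℕ → ℂ) (E : ℕ → ℂ)
    (hk : ∀ i, i ≤ a + b + 1 → 0 < k i) (hx : ∀ i, i ≤ a + b + 1 → ‖x i‖ = 1)
    (h0 : ¬(k 0 = 1 ∧ x 0 = 1)) (hr : ¬(k (a + b + 1) = 1 ∧ x (a + b + 1) = 1))
    (i m0 : ℕ) (mn : ℕ → ℕ) :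
    AS (fun N : ℕ => NS (a + b + 1) 0 ((N : ℤ) + 1) (fun c =>
      E i * ((∏ l ∈ (Finset.range (a + b + 1)).erase a, (cf (k (l + 1)) (mn l) *
        hh (k (l + 1) + mn l, x (l + 1)) (c l - c a))) *
        (cf (k 0) m0 * hh (k 0 + m0, x 0) (-c a)))))
      ((-1 : ℂ) ^ ((∑ t ∈ Finset.range (a + 1), k t) + ∑ t ∈ Finset.range b, mn (a + 1 + t))
        * (Nat.choose (m0 + k 0 - 1) (k 0 - 1) : ℂ)
        * (∏ l ∈ (Finset.range (a + b + 1)).erase a,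
              (Nat.choose (mn l + k (l + 1) - 1) (k (l + 1) - 1) : ℂ))
        * E i
        * cmzv ((List.range b).map fun t => (k (a + 1 + t + 1) + mn (a + 1 + t), x (a + 1 + t + 1)))
        * cmzv (il ((List.range a).map fun t => (k (t + 1) + mn t, x (t + 1))) ++
            [(k 0 + m0, (x 0)⁻¹)])) := by
  set Q : ℕ → ℕ × ℂ := fun l => (k (l + 1) + mn l, x (l + 1)) with hQ
  have e1 : ∀ c : ℕ → ℤ, E i * ((∏ l ∈ (Finset.range (a + b + 1)).erase a, (cf (k (l + 1)) (mn l) *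
        hh (k (l + 1) + mn l, x (l + 1)) (c l - c a))) *
        (cf (k 0) m0 * hh (k 0 + m0, x 0) (-c a))) =
      (E i * (∏ l ∈ (Finset.range (a + b + 1)).erase a, cf (k (l + 1)) (mn l)) * cf (k 0) m0) *
      ((∏ l ∈ (Finset.range (a + b + 1)).erase a,
        hh (Q l) (c l - c a)) * hh (k 0 + m0, x 0) (-c a)) := by
    intro c
    rw [Finset.prod_mul_distrib]; ring
  simp only [e1, NS_mul, poleN a b Q]
  have hs : sg ((List.range a).map Q) = (-1) ^ (∑ t ∈ Finset.range a, k (t + 1)) *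
      (-1) ^ (∑ t ∈ Finset.range a, mn t) := by
    unfold sg
    rw [List.map_map, list_sum_range, ← pow_add, ← Finset.sum_add_distrib]
    rfl
  have hA : Adm (il ((List.range a).map Q) ++ [(k 0 + m0, (x 0)⁻¹)]) := by
    have k0 := hk 0 (by omega)
    refine Adm_snoc _ _ ?_ ⟨by simp only; omega, by simp [hx 0 (by omega)]⟩ ?_
    · intro p hp
      simp only [il, List.mem_reverse, List.mem_map, List.mem_range] at hp
      obtain ⟨_, ⟨t, ht, rfl⟩, rfl⟩ := hp
      have := hk (t + 1) (by omega)
      refine ⟨?_, ?_⟩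
      · simp only [hQ]; omega
      · simp only [hQ, norm_inv, hx (t + 1) (by omega), inv_one]
    · rintro ⟨h1, h2⟩
      simp only [inv_eq_one] at h1 h2
      exact h0 ⟨by omega, h2⟩
  have hB : Adm ((List.range b).map fun t => Q (a + 1 + t)) := by
    have : (List.range b).map (fun t => Q (a + 1 + t)) = List.ofFn fun t : Fin b => Q (a + 1 + t) := by
      rw [List.ofFn_eq_map, ← List.map_coe_finRange_eq_range, List.map_map]; rfl
    rw [this]
    refine Adm_ofFn _ _ (fun t => ⟨?_, hx _ (by omega)⟩) (fun t ht => ?_)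
    · have := hk (a + 1 + t.val + 1) (by omega)
      simp only [hQ]; omega
    · simp only [hQ]
      have e : a + 1 + t.val + 1 = a + b + 1 := by omega
      have := hk (a + b + 1) le_rfl
      rw [e]
      rintro ⟨h1, h2⟩
      exact hr ⟨by omega, h2⟩
  have key := (cv_AS _ _ _ hA hB).const_mul
    ((E i * (∏ l ∈ (Finset.range (a + b + 1)).erase a, cf (k (l + 1)) (mn l)) * cf (k 0) m0) *
      (sg ((List.range a).map Q) * (-1) ^ (k 0 + m0)))
  have hval : (E i * (∏ l ∈ (Finset.range (a + b + 1)).erase a, cf (k (l + 1)) (mn l)) * cf (k 0) m0) *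
      (sg ((List.range a).map Q) * (-1) ^ (k 0 + m0)) =
      (-1 : ℂ) ^ ((∑ t ∈ Finset.range (a + 1), k t) + ∑ t ∈ Finset.range b, mn (a + 1 + t))
        * (Nat.choose (m0 + k 0 - 1) (k 0 - 1) : ℂ)
        * (∏ l ∈ (Finset.range (a + b + 1)).erase a,
              (Nat.choose (mn l + k (l + 1) - 1) (k (l + 1) - 1) : ℂ))
        * E i := by
    simp only [cf, Finset.prod_mul_distrib]
    rw [prod_erase_range a b (fun l => (-1 : ℂ) ^ mn l), Finset.prod_pow_eq_pow_sum,
      Finset.prod_pow_eq_pow_sum, hs, Finset.sum_range_succ', pow_add, pow_add, pow_add]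
    have h1 : ∀ n : ℕ, (-1 : ℂ) ^ n * (-1) ^ n = 1 := fun n => by rw [← mul_pow]; simp
    linear_combination (E i * (-1) ^ (∑ t ∈ Finset.range b, mn (a + 1 + t)) *
      (-1 : ℂ) ^ (∑ t ∈ Finset.range a, k (t + 1)) * (-1) ^ k 0 *
      (Nat.choose (m0 + k 0 - 1) (k 0 - 1) : ℂ)
        * (∏ l ∈ (Finset.range (a + b + 1)).erase a,
              (Nat.choose (mn l + k (l + 1) - 1) (k (l + 1) - 1) : ℂ))) *
      ((-1 : ℂ) ^ m0 * (-1) ^ m0 * h1 (∑ t ∈ Finset.range a, mn t) + h1 m0)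
  rw [hval] at key
  convert key using 1
  · funext N; rw [← hval]; ring
  · ring

/-- extension of a tuple by zero -/
def exN {r : ℕ} (mm : Fin r → ℕ) (l : ℕ) : ℕ := if h : l < r then mm ⟨l, h⟩ else 0

lemma exN_eq {r : ℕ} (mm : Fin r → ℕ) (l : ℕ) (h : l < r) : exN mm l = mm ⟨l, h⟩ := dif_pos h

lemma AS_PJ (r : ℕ) (k : ℕ → ℕ) (x : ℕ → ℂ) (E : ℕ → ℂ)
    (hk : ∀ i, i ≤ r → 0 < k i) (hx : ∀ i, i ≤ r → ‖x i‖ = 1)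
    (h0 : ¬(k 0 = 1 ∧ x 0 = 1)) (hr : ¬(k r = 1 ∧ x r = 1)) (j : Fin r) :
    AS (fun N : ℕ => NS r 0 ((N : ℤ) + 1) (PJ r k x E j))
      (∑ i ∈ Finset.range (k (j.val + 1) + 1),
        ∑ m ∈ Finset.range (k (j.val + 1) + 1 - i),
        ∑ mm ∈ (Finset.Nat.antidiagonalTuple r m).filter (fun mm => mm j = 0),
          (-1 : ℂ) ^ ((∑ t ∈ Finset.range (j.val + 1), k t)
              + ∑ l ∈ Finset.univ.filter (fun l => j < l), mm l)
          * (Nat.choose (k 0 + k (j.val + 1) - m - i - 1) (k 0 - 1) : ℂ)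
          * (∏ l ∈ Finset.univ.erase j,
              (Nat.choose (mm l + k (l.val + 1) - 1) (k (l.val + 1) - 1) : ℂ))
          * E i
          * cmzv (List.ofFn fun t : Fin (r - (j.val + 1)) =>
              (k (j.val + 2 + t.val) + exN mm (j.val + 1 + t.val),
                x (j.val + 2 + t.val)))
          * cmzv ((List.ofFn fun t : Fin j.val =>
              (k (j.val - t.val) + exN mm (j.val - 1 - t.val),
                (x (j.val - t.val))⁻¹))
              ++ [(k 0 + k (j.val + 1) - i - m, (x 0)⁻¹)])) := by
  obtain ⟨a, b, ha, rfl⟩ : ∃ a b, j.val = a ∧ r = a + b + 1 :=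
    ⟨j.val, r - j.val - 1, rfl, by have := j.2; omega⟩
  unfold PJ
  simp only [NS_sum]
  refine AS.sum _ _ _ fun i hi => AS.sum _ _ _ fun m hm => AS.sum _ _ _ fun mm hmm => ?_
  rw [Finset.mem_range] at hi hm
  set mn : ℕ → ℕ := exN mm with hmn
  have hmv : ∀ l : Fin (a + b + 1), mm l = mn l.val := fun l => by simp only [hmn, exN, dif_pos l.2]
  have key := AS_PJterm a b k x E hk hx h0 hr i (k (j.val + 1) - i - m) mn
  have e1 : ∀ c : ℕ → ℤ, ∏ l ∈ Finset.univ.erase j, (cf (k (l.val + 1)) (mm l) *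
        hh (k (l.val + 1) + mm l, x (l.val + 1)) (c l - c j)) =
      ∏ l ∈ (Finset.range (a + b + 1)).erase a, (cf (k (l + 1)) (mn l) *
        hh (k (l + 1) + mn l, x (l + 1)) (c l - c a)) := by
    intro c
    simp only [hmv]
    rw [prod_fin_erase _ j (fun l => cf (k (l + 1)) (mn l) *
        hh (k (l + 1) + mn l, x (l + 1)) (c l - c j)), ha]
  have e2 : ∏ l ∈ Finset.univ.erase j,
      (Nat.choose (mm l + k (l.val + 1) - 1) (k (l.val + 1) - 1) : ℂ) =
      ∏ l ∈ (Finset.range (a + b + 1)).erase a,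
              (Nat.choose (mn l + k (l + 1) - 1) (k (l + 1) - 1) : ℂ) := by
    simp only [hmv]
    rw [prod_fin_erase _ j (fun l => (Nat.choose (mn l + k (l + 1) - 1) (k (l + 1) - 1) : ℂ)), ha]
  have e3 : ∑ l ∈ Finset.univ.filter (fun l => j < l), mm l
      = ∑ t ∈ Finset.range b, mn (a + 1 + t) := by
    simp only [hmv]
    exact sum_fin_gt a b j ha mn
  have e4 : (List.ofFn fun t : Fin (a + b + 1 - (j.val + 1)) =>
              (k (j.val + 2 + t.val) + exN mm (j.val + 1 + t.val),
                x (j.val + 2 + t.val))) =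
      (List.range b).map fun t => (k (a + 1 + t + 1) + mn (a + 1 + t), x (a + 1 + t + 1)) := by
    apply List.ext_getElem
    · simp [ha]
    · intro n h1 h2
      simp only [List.getElem_ofFn, List.getElem_map, List.getElem_range]
      rw [ha, show a + 2 + n = a + 1 + n + 1 by ring]
  have e5 : (List.ofFn fun t : Fin j.val =>
              (k (j.val - t.val) + exN mm (j.val - 1 - t.val),
                (x (j.val - t.val))⁻¹)) =
      il ((List.range a).map fun t => (k (t + 1) + mn t, x (t + 1))) := by
    apply List.ext_getElem
    · simp [ha, il]
    · intro n h1 h2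
      simp only [List.length_ofFn] at h1
      simp only [il, List.getElem_ofFn, List.getElem_map, List.getElem_range, List.getElem_reverse,
        List.length_map, List.length_range]
      rw [ha, show a - 1 - n + 1 = a - n by omega]
  have e6 : k 0 + k (j.val + 1) - m - i - 1 = k (j.val + 1) - i - m + k 0 - 1 := by omega
  have e7 : k 0 + k (j.val + 1) - i - m = k 0 + (k (j.val + 1) - i - m) := by omega
  simp only [e1]
  rw [e2, e3, e4, e5, e6, e7]
  simp only [ha] at key ⊢
  exact key

lemma NS_L (r : ℕ) (k : ℕ → ℕ) (x : ℕ → ℂ) (hi n : ℤ) :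
    NS r 0 hi (fun c => hh (k 0, x 0) n * ∏ l ∈ Finset.range r,
      hh (k (l + 1), x (l + 1)) (n + c l)) =
    hh (k 0, x 0) n * CP ((List.range r).map fun l => (k (l + 1), x (l + 1))) n (n + hi) := by
  rw [NS_mul]
  have := NS_shift r 0 hi (-n) (fun l => (k (l + 1), x (l + 1)))
  simp only [sub_neg_eq_add, zero_add] at this
  rw [add_comm n hi, ← this]
  simp only [add_comm n]

end SymC
namespace SymC

lemma cmzv_nil : cmzv [] = 1 := by
  have h := CP_tendsto [] ⟨by simp, by simp⟩
  simp only [CP, List.map_nil, CL] at h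
  exact tendsto_nhds_unique h tendsto_const_nhds

lemma norm_root {z : ℂ} (h : IsRootOfUnity z) : ‖z‖ = 1 := by
  obtain ⟨N, hN, h⟩ := h
  exact Complex.norm_eq_one_of_pow_eq_one h hN.ne'

noncomputable def KK (r : ℕ) (k : ℕ → ℕ) (x : ℕ → ℂ) : List (ℕ × ℂ) :=
  (List.range r).map fun l => (k (l + 1), x (l + 1))

lemma KK_succ (r : ℕ) (k : ℕ → ℕ) (x : ℕ → ℂ) :
    KK (r + 1) k x = KK r k x ++ [(k (r + 1), x (r + 1))] := by
  simp [KK, List.range_succ]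

lemma KK_len (r : ℕ) (k : ℕ → ℕ) (x : ℕ → ℂ) : (KK r k x).length = r := by simp [KK]

lemma list1 (r : ℕ) (k : ℕ → ℕ) (x : ℕ → ℂ) :
    (List.ofFn fun i : Fin (r + 1) => (k i.val, x i.val)) = (k 0, x 0) :: KK r k x := by
  rw [List.ofFn_succ]
  congr 1
  apply List.ext_getElem
  · simp [KK]
  · intro n h1 h2
    simp [KK]

lemma list2 (r j : ℕ) (k : ℕ → ℕ) (x : ℕ → ℂ) :
    (List.ofFn fun t : Fin (r - j) => (k (j + 1 + t.val), x (j + 1 + t.val))) =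
      (KK r k x).drop j := by
  apply List.ext_getElem
  · simp [KK]
  · intro n h1 h2
    simp only [KK, List.getElem_ofFn, List.getElem_drop, List.getElem_map, List.getElem_range]
    rw [show j + 1 + n = j + n + 1 by ring]

lemma take_KK (r j : ℕ) (hj : j ≤ r) (k : ℕ → ℕ) (x : ℕ → ℂ) : (KK r k x).take j = KK j k x := by
  unfold KK
  rw [← List.map_take, List.take_range, min_eq_left hj]

lemma list3 (j : ℕ) (k : ℕ → ℕ) (x : ℕ → ℂ) :
    (List.ofFn fun t : Fin (j + 1) => (k (j - t.val), (x (j - t.val))⁻¹)) =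
      il (KK j k x) ++ [(k 0, (x 0)⁻¹)] := by
  induction j with
  | zero => simp [KK, il]
  | succ j ih =>
    have e : il (KK (j + 1) k x) = (k (j + 1), (x (j + 1))⁻¹) :: il (KK j k x) := by
      rw [KK_succ]; simp [il]
    rw [e, List.cons_append, ← ih, List.ofFn_succ]
    simp

lemma sg_KK (j : ℕ) (k : ℕ → ℕ) (x : ℕ → ℂ) :
    (-1 : ℂ) ^ (∑ i ∈ Finset.range (j + 1), k i) = (-1) ^ k 0 * sg (KK j k x) := by
  unfold sg KK
  rw [List.map_map, list_sum_range, Finset.sum_range_succ', add_comm, pow_add]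
  rfl

lemma main_pos (r : ℕ) (k : ℕ → ℕ) (x : ℕ → ℂ)
    (hk : ∀ i, i ≤ r + 1 → 0 < k i)
    (hx : ∀ i, i ≤ r + 1 → ‖x i‖ = 1)
    (h0 : ¬(k 0 = 1 ∧ x 0 = 1)) (hr : ¬(k (r + 1) = 1 ∧ x (r + 1) = 1))
    (X : ℂ) (hX : X = ∏ i ∈ Finset.range (r + 1 + 1), x i) (hX1 : X ≠ 1)
    (E : ℕ → ℂ) (hE0 : E 0 = -1)
    (hE : ∀ t, 1 ≤ t → E t = (-1 : ℂ) ^ t * li1 t X⁻¹ + li1 t X) (R0 : ℂ) (RJ : Fin (r + 1) → ℂ)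
    (hR0 : AS (fun N : ℕ => NS (r + 1) 0 ((N : ℤ) + 1) (P0 (r + 1) k x E)) R0)
    (hRJ : ∀ j, AS (fun N : ℕ => NS (r + 1) 0 ((N : ℤ) + 1) (PJ (r + 1) k x E j)) (RJ j)) :
    cmzv (List.ofFn fun i : Fin (r + 1 + 1) => (k i.val, x i.val))
    + (∑ j : Fin (r + 1 + 1), (-1 : ℂ) ^ (∑ i ∈ Finset.range (j.val + 1), k i)
        * cmzv (List.ofFn fun t : Fin (r + 1 - j.val) =>
          (k (j.val + 1 + t.val), x (j.val + 1 + t.val)))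
        * cmzv (List.ofFn fun t : Fin (j.val + 1) => (k (j.val - t.val), (x (j.val - t.val))⁻¹)))
    = R0 + ∑ j, RJ j := by
  have hXn : ‖X‖ = 1 := by
    rw [hX, norm_prod]
    exact Finset.prod_eq_one fun i hi => hx i (by have := Finset.mem_range.1 hi; omega)
  have hx0 : ∀ i, i ≤ r + 1 → x i ≠ 0 := fun i hi h => by
    have := hx i hi; rw [h] at this; simp at this
  have hE' : ∀ t, 1 ≤ t → ∀ q : ℤ, Tendsto (fun N : ℕ => ∑ n ∈ Finset.Icc (-(N : ℤ)) N,
      X ^ n * (((n : ℂ) - q)⁻¹) ^ t) atTop (nhds (X ^ q * E t)) := by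
    intro t ht q
    rw [hE t ht]
    exact two_sided X hXn hX1 t ht q
  have hmem : ∀ j, j ≤ r + 1 → ∀ p ∈ KK j k x, 0 < p.1 ∧ ‖p.2‖ = 1 := by
    intro j hj p hp
    simp only [KK, List.mem_map, List.mem_range] at hp
    obtain ⟨t, ht, rfl⟩ := hp
    exact ⟨hk _ (by omega), hx _ (by omega)⟩
  have hA : Adm ((k 0, x 0) :: KK (r + 1) k x) := by
    rw [← list1]
    refine Adm_ofFn _ _ (fun i => ⟨hk _ (by omega), hx _ (by omega)⟩) (fun i hi => ?_)
    have : i.val = r + 1 := by omega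
    simp only [this]; exact hr
  have hBj : ∀ j, j ≤ r + 1 → Adm (il (KK j k x) ++ [(k 0, (x 0)⁻¹)]) := by
    intro j hj
    refine Adm_snoc _ _ ?_ ⟨hk 0 (by omega), by simp [hx 0 (by omega)]⟩ (by
      simp only [inv_eq_one]; exact h0)
    intro p hp
    simp only [il, List.mem_reverse, List.mem_map] at hp
    obtain ⟨q, hq, rfl⟩ := hp
    have := hmem j hj q hq
    exact ⟨this.1, by simp [this.2]⟩
  have hB : Adm (il ((k 0, x 0) :: KK (r + 1) k x)) := by
    have : il ((k 0, x 0) :: KK (r + 1) k x) = il (KK (r + 1) k x) ++ [(k 0, (x 0)⁻¹)] := by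
      simp [il]
    rw [this]; exact hBj _ le_rfl
  -- the two limits agree for each cutoff
  have hL : ∀ hi : ℤ, Sp (k 0, x 0) (KK (r + 1) k x) hi
        + (∑ j ∈ Finset.range (r + 1), (-1) ^ k 0 * sg (KK j k x) *
          cv (il (KK j k x)) (k 0, (x 0)⁻¹) ((KK (r + 1) k x).drop j) hi)
        + sg ((k 0, x 0) :: KK (r + 1) k x) *
          Sp (k (r + 1), (x (r + 1))⁻¹) (il (KK r k x) ++ [(k 0, (x 0)⁻¹)]) hi
      = NS (r + 1) 0 hi (P0 (r + 1) k x E) + ∑ J, NS (r + 1) 0 hi (PJ (r + 1) k x E J) := by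
    intro hi
    rw [KK_succ] at hA hB
    have l1 := Lside (k 0, x 0) (k (r + 1), x (r + 1)) (KK r k x) hA hB hi
    have l2 := NS_tendsto (r + 1) 0 hi (fun N c => ∑ n ∈ Finset.Icc (-(N : ℤ)) N,
      hh (k 0, x 0) n * ∏ l ∈ Finset.range (r + 1), hh (k (l + 1), x (l + 1)) (n + c l)) _
      (fun c hc => chain_lim (r + 1) k x X E hk hx0 hX hE0 hE' hi c hc)
    simp only [NS_sum, NS_L] at l2
    change Tendsto (fun N : ℕ => ∑ n ∈ Finset.Icc (-(N : ℤ)) N,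
      hh (k 0, x 0) n * CP (KK (r + 1) k x) n (n + hi)) _ _ at l2
    rw [← KK_succ] at l1
    have := tendsto_nhds_unique l1 l2
    have e : NS (r + 1) 0 hi (fun c => P0 (r + 1) k x E c + ∑ J, PJ (r + 1) k x E J c) =
        NS (r + 1) 0 hi (P0 (r + 1) k x E) + ∑ J, NS (r + 1) 0 hi (PJ (r + 1) k x E J) := by
      rw [← NS_sum Finset.univ]
      have := NS_sum (Finset.univ : Finset (Fin 2)) (r + 1) 0 hi
        (fun i => if i = 0 then P0 (r + 1) k x E else fun c => ∑ J, PJ (r + 1) k x E J c)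
      simpa [Fin.sum_univ_two] using this
    rw [← e, ← this, KK_len]
    congr 2
    refine Finset.sum_congr rfl fun j hj => ?_
    rw [take_KK _ _ (by have := Finset.mem_range.1 hj; omega)]
  have aL : AS (fun N : ℕ => Sp (k 0, x 0) (KK (r + 1) k x) ((N : ℤ) + 1)
        + (∑ j ∈ Finset.range (r + 1), (-1) ^ k 0 * sg (KK j k x) *
          cv (il (KK j k x)) (k 0, (x 0)⁻¹) ((KK (r + 1) k x).drop j) ((N : ℤ) + 1))
        + sg ((k 0, x 0) :: KK (r + 1) k x) *
          Sp (k (r + 1), (x (r + 1))⁻¹) (il (KK r k x) ++ [(k 0, (x 0)⁻¹)]) ((N : ℤ) + 1))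
      (cmzv ((k 0, x 0) :: KK (r + 1) k x) + (∑ j ∈ Finset.range (r + 1), (-1) ^ k 0 * sg (KK j k x) *
          (cmzv (il (KK j k x) ++ [(k 0, (x 0)⁻¹)]) * cmzv ((KK (r + 1) k x).drop j)))
        + sg ((k 0, x 0) :: KK (r + 1) k x) *
          cmzv ((k (r + 1), (x (r + 1))⁻¹) :: (il (KK r k x) ++ [(k 0, (x 0)⁻¹)]))) := by
    refine ((Sp_AS _ _ (by rw [KK_succ]; simp) hA).add (AS.sum _ _ _ fun j hj => ?_)).add
      (AS.const_mul _ (Sp_AS _ _ (by simp) ?_))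
    · have hj' := Finset.mem_range.1 hj
      refine AS.const_mul _ (cv_AS _ _ _ (hBj j (by omega)) ?_)
      rw [← list2]
      refine Adm_ofFn _ _ (fun i => ⟨hk _ (by omega), hx _ (by omega)⟩) (fun i hi => ?_)
      have : j + 1 + i.val = r + 1 := by omega
      simp only [this]; exact hr
    · have := hBj (r + 1) le_rfl
      rw [KK_succ] at this
      simpa [il] using this
  simp only [hL] at aL
  have aR := hR0.add (AS.sum Finset.univ _ _ fun j _ => hRJ j)
  have := aL.unique aR
  rw [← this, list1]
  simp only [list2, list3, sg_KK _ k x]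
  rw [← Finset.sum_range (fun j => (-1 : ℂ) ^ k 0 * sg (KK j k x) *
    cmzv ((KK (r + 1) k x).drop j) * cmzv (il (KK j k x) ++ [(k 0, (x 0)⁻¹)])),
    Finset.sum_range_succ, ← add_assoc]
  congr 1
  · congr 1
    exact Finset.sum_congr rfl fun j _ => by ring
  · rw [List.drop_of_length_le (by rw [KK_len]), cmzv_nil, sg_cons, KK_succ]
    simp [il]

lemma main_zero (k : ℕ → ℕ) (x : ℕ → ℂ) (E : ℕ → ℂ)
    (hE : E (k 0) = (-1 : ℂ) ^ k 0 * li1 (k 0) (x 0)⁻¹ + li1 (k 0) (x 0)) :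
    cmzv [(k 0, x 0)] + (-1 : ℂ) ^ k 0 * cmzv [(k 0, (x 0)⁻¹)] = E (k 0) := by
  rw [hE]; unfold li1; ring

end SymC

/-- Symmetry theorem for cyclotomic multiple zeta values (Theorem 1 / `mainthm-CMZVs`). -/
theorem symmetry_cmzv (r : ℕ) (k : ℕ → ℕ) (x : ℕ → ℂ)
    (hk : ∀ i, i ≤ r → 0 < k i)
    (hx : ∀ i, i ≤ r → IsRootOfUnity (x i))
    (h0 : ¬(k 0 = 1 ∧ x 0 = 1)) (hr : ¬(k r = 1 ∧ x r = 1))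
    (X : ℂ) (hX : X = ∏ i ∈ Finset.range (r + 1), x i) (hX1 : X ≠ 1)
    (E : ℕ → ℂ) (hE0 : E 0 = -1)
    (hE : ∀ t, 1 ≤ t → E t = (-1 : ℂ) ^ t * li1 t X⁻¹ + li1 t X) :
    cmzv (List.ofFn fun i : Fin (r + 1) => (k i.val, x i.val))
    + (∑ j : Fin (r + 1), (-1 : ℂ) ^ (∑ i ∈ Finset.range (j.val + 1), k i)
        * cmzv (List.ofFn fun t : Fin (r - j.val) => (k (j.val + 1 + t.val), x (j.val + 1 + t.val)))
        * cmzv (List.ofFn fun t : Fin (j.val + 1) => (k (j.val - t.val), (x (j.val - t.val))⁻¹)))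
    - (∑ j ∈ Finset.range (k 0 + 1), ∑ m ∈ Finset.Nat.antidiagonalTuple r (k 0 - j),
        ((-1 : ℂ) ^ (k 0 - j)
            * ∏ l : Fin r, (Nat.choose (m l + k (l.val + 1) - 1) (k (l.val + 1) - 1) : ℂ))
          * E j
          * cmzv (List.ofFn fun l : Fin r => (k (l.val + 1) + m l, x (l.val + 1))))
    - (∑ j : Fin r, ∑ i ∈ Finset.range (k (j.val + 1) + 1),
        ∑ m ∈ Finset.range (k (j.val + 1) + 1 - i),
        ∑ mm ∈ (Finset.Nat.antidiagonalTuple r m).filter (fun mm => mm j = 0),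
          (-1 : ℂ) ^ ((∑ t ∈ Finset.range (j.val + 1), k t)
              + ∑ l ∈ Finset.univ.filter (fun l => j < l), mm l)
          * (Nat.choose (k 0 + k (j.val + 1) - m - i - 1) (k 0 - 1) : ℂ)
          * (∏ l ∈ Finset.univ.erase j,
              (Nat.choose (mm l + k (l.val + 1) - 1) (k (l.val + 1) - 1) : ℂ))
          * E i
          * cmzv (List.ofFn fun t : Fin (r - (j.val + 1)) =>
              (k (j.val + 2 + t.val) + mm ⟨j.val + 1 + t.val, by have := t.isLt; omega⟩,
                x (j.val + 2 + t.val)))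
          * cmzv ((List.ofFn fun t : Fin j.val =>
              (k (j.val - t.val) + mm ⟨j.val - 1 - t.val, by have := t.isLt; have := j.isLt; omega⟩,
                (x (j.val - t.val))⁻¹))
              ++ [(k 0 + k (j.val + 1) - i - m, (x 0)⁻¹)]))
    = 0 := by
  cases r with
  | zero =>
    have hX0 : X = x 0 := by rw [hX]; simp
    have hz := SymC.main_zero k x E (by rw [hE _ (hk 0 le_rfl), hX0])
    rw [Finset.sum_eq_single (k 0)]
    · simp [SymC.cmzv_nil]
      rw [← hz]; ring
    · intro j hj hne
      have : j < k 0 + 1 := Finset.mem_range.1 hj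
      obtain ⟨d, hd⟩ : ∃ d, k 0 - j = d + 1 := ⟨k 0 - j - 1, by omega⟩
      rw [hd, Finset.Nat.antidiagonalTuple_zero_succ, Finset.sum_empty]
    · intro h; simp at h
  | succ r =>
    have hx' : ∀ i, i ≤ r + 1 → ‖x i‖ = 1 := fun i hi => SymC.norm_root (hx i hi)
    have h := SymC.main_pos r k x hk hx' h0 hr X hX hX1 E hE0 hE _ _
      (SymC.AS_P0 (r + 1) k x E hk hx' hr)
      (fun j => SymC.AS_PJ (r + 1) k x E hk hx' h0 hr j)
    rw [h, add_sub_cancel_left, sub_eq_zero]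
    refine Finset.sum_congr rfl fun j _ => Finset.sum_congr rfl fun i _ =>
      Finset.sum_congr rfl fun m _ => Finset.sum_congr rfl fun mm _ => ?_
    refine congrArg₂ (· * ·) (congrArg₂ (· * ·) rfl (congrArg cmzv (congrArg List.ofFn
      (funext fun t => ?_)))) (congrArg (fun L => cmzv (L ++ _)) (congrArg List.ofFn
      (funext fun t => ?_)))
    · rw [SymC.exN_eq mm]
    · rw [SymC.exN_eq mm]
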